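/- arXiv:2002.02247 — 6 statements merged into one kernel-verified Lean document; each statement's English description precedes it below -/
import Mathlib

section
/- Fix layer dimensions d_0, …, d_L and let r ≥ 1. Suppose the activation σ is r times continuously differentiable and each derivative σ^{(j)} (0 ≤ j ≤ r) is polynomially bounded: |σ^{(j)}(z)| ≤ C_j(1+z²)^{k_j} for all z ∈ ℝ. Let (F, X, Y) be a random variable with F = (F_L, …, F_1) valued in products of {0,1}-matrices and (X, Y) valued in ℝ^{d_0} × ℝ^{d_L}, with E[‖Y‖₂^m ‖X‖₂^n] < ∞ for all m ∈ {0,1,2} and n ∈ ℕ. Then the dropout risk function 𝒟(W) := E[l(Ψ_{F⊙W}(X), Y)] is (r−1) times continuously differentiable on the space of weight tuples, and its gradient satisfies ∇𝒟(W) = E[F ⊙ ∇_W l(Ψ_{F⊙W}(X), Y)] for every W (the derivative and expectation may be exchanged). -/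
open MeasureTheory

/-- Euclidean (`ℓ₂`) norm of a vector in `ℝ^d`. -/
noncomputable def l2norm {d : ℕ} (v : Fin d → ℝ) : ℝ := Real.sqrt (∑ i, v i ^ 2)

/-- Hidden-layer activations: `A₀ = x`, `A_{i+1} = σ(W_i A_i)` (entrywise `σ`). -/
noncomputable def hiddenLayer (σ : ℝ → ℝ) (d : ℕ → ℕ)
    (W : ∀ i : ℕ, Fin (d (i + 1)) → Fin (d i) → ℝ) (x : Fin (d 0) → ℝ) :
    ∀ i : ℕ, Fin (d i) → ℝ
  | 0 => x
  | i + 1 => fun r => σ (∑ j, W i r j * hiddenLayer σ d W x i j)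

/-- Output `Ψ_W(x)` of the `L`-layer network: the last layer is affine (no activation). -/
noncomputable def netOut (σ : ℝ → ℝ) (d : ℕ → ℕ)
    (W : ∀ i : ℕ, Fin (d (i + 1)) → Fin (d i) → ℝ) (x : Fin (d 0) → ℝ) :
    ∀ L : ℕ, Fin (d L) → ℝ
  | 0 => x
  | L + 1 => fun r => ∑ j, W L r j * hiddenLayer σ d W x L j

/-- The dropout loss `W ↦ l(Ψ_{f ⊙ W}(x), y)` with `l(u,y) = ‖u − y‖₂²`. -/
noncomputable def dropLoss (σ : ℝ → ℝ) (d : ℕ → ℕ) (L : ℕ)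
    (f : ∀ i : ℕ, Fin (d (i + 1)) → Fin (d i) → ℝ)
    (x : Fin (d 0) → ℝ) (y : Fin (d L) → ℝ)
    (W : ∀ i : ℕ, Fin (d (i + 1)) → Fin (d i) → ℝ) : ℝ :=
  ∑ r, (netOut σ d (fun i a b => f i a b * W i a b) x L r - y r) ^ 2

/-- Extension of an `L`-tuple of weight matrices to an `ℕ`-indexed family (zero beyond `L`). -/
noncomputable def extendW (d : ℕ → ℕ) (L : ℕ)
    (W : ∀ i : Fin L, Fin (d (i.1 + 1)) → Fin (d i.1) → ℝ) :
    ∀ i : ℕ, Fin (d (i + 1)) → Fin (d i) → ℝ :=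
  fun i => if h : i < L then W ⟨i, h⟩ else fun _ _ => 0

/-- The weight collection `W` with the single entry `(i, r, s)` replaced by `t`. -/
noncomputable def entryUpdate (d : ℕ → ℕ)
    (W : ∀ i : ℕ, Fin (d (i + 1)) → Fin (d i) → ℝ)
    (i : ℕ) (r : Fin (d (i + 1))) (s : Fin (d i)) (t : ℝ) :
    ∀ j : ℕ, Fin (d (j + 1)) → Fin (d j) → ℝ :=
  Function.update W i (Function.update (W i) r (Function.update (W i r) s t))

/-- Partial derivative with respect to weight entry `(i, r, s)` (`ℕ`-indexed weights). -/
noncomputable def pderivEntry (d : ℕ → ℕ)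
    (g : (∀ i : ℕ, Fin (d (i + 1)) → Fin (d i) → ℝ) → ℝ)
    (W : ∀ i : ℕ, Fin (d (i + 1)) → Fin (d i) → ℝ)
    (i : ℕ) (r : Fin (d (i + 1))) (s : Fin (d i)) : ℝ :=
  deriv (fun t => g (entryUpdate d W i r s t)) (W i r s)

/-- Partial derivative with respect to weight entry `(i, a, b)` (`Fin L`-indexed weights). -/
noncomputable def pderivFin (d : ℕ → ℕ) (L : ℕ)
    (g : (∀ i : Fin L, Fin (d (i.1 + 1)) → Fin (d i.1) → ℝ) → ℝ)
    (W : ∀ i : Fin L, Fin (d (i.1 + 1)) → Fin (d i.1) → ℝ)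
    (i : Fin L) (a : Fin (d (i.1 + 1))) (b : Fin (d i.1)) : ℝ :=
  deriv (fun t =>
    g (Function.update W i (Function.update (W i) a (Function.update (W i a) b t)))) (W i a b)

/-- The dropout risk function `𝒟(W) = E[l(Ψ_{F⊙W}(X), Y)]`. -/
noncomputable def dropRisk (σ : ℝ → ℝ) (d : ℕ → ℕ) (L : ℕ)
    {Ω : Type*} [MeasurableSpace Ω] (μ : Measure Ω)
    (F : Ω → ∀ i : ℕ, Fin (d (i + 1)) → Fin (d i) → ℝ)
    (X : Ω → Fin (d 0) → ℝ) (Y : Ω → Fin (d L) → ℝ)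
    (W : ∀ i : Fin L, Fin (d (i.1 + 1)) → Fin (d i.1) → ℝ) : ℝ :=
  ∫ ω, dropLoss σ d L (F ω) (X ω) (Y ω) (extendW d L W) ∂μ

/-- `Φ` is `n` times continuously differentiable and its derivatives up to order `n` grow at most
polynomially. -/
structure PolyContDiff {E G : Type*} [NormedAddCommGroup E] [NormedSpace ℝ E]
    [NormedAddCommGroup G] [NormedSpace ℝ G] (n : ℕ) (Φ : E → G) : Prop where
  contDiff : ContDiff ℝ n Φ
  bound : ∃ (N : ℕ) (C : ℝ), 0 ≤ C ∧
    ∀ k ≤ n, ∀ x, ‖iteratedFDeriv ℝ k Φ x‖ ≤ C * (1 + ‖x‖) ^ N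

namespace PolyContDiff

variable {E G H : Type*} [NormedAddCommGroup E] [NormedSpace ℝ E]
  [NormedAddCommGroup G] [NormedSpace ℝ G] [NormedAddCommGroup H] [NormedSpace ℝ H] {n : ℕ}

theorem of_hasTemperateGrowth {Φ : E → G} (h : Φ.HasTemperateGrowth) : PolyContDiff n Φ :=
  ⟨h.1.of_le (mod_cast le_top), h.norm_iteratedFDeriv_le_uniform n⟩

theorem clm (f : E →L[ℝ] G) : PolyContDiff n (fun x => f x) :=
  of_hasTemperateGrowth f.hasTemperateGrowth

theorem const (c : G) : PolyContDiff n (fun _ : E => c) :=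
  of_hasTemperateGrowth (Function.HasTemperateGrowth.const c)

theorem of_le {m : ℕ} {Φ : E → G} (h : PolyContDiff n Φ) (hmn : m ≤ n) : PolyContDiff m Φ := by
  obtain ⟨N, C, hC, hb⟩ := h.bound
  exact ⟨h.contDiff.of_le (mod_cast hmn), N, C, hC, fun k hk => hb k (hk.trans hmn)⟩

theorem add {Φ Ψ : E → G} (hΦ : PolyContDiff n Φ) (hΨ : PolyContDiff n Ψ) :
    PolyContDiff n (fun x => Φ x + Ψ x) := by
  obtain ⟨N₁, C₁, hC₁, h₁⟩ := hΦ.bound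
  obtain ⟨N₂, C₂, hC₂, h₂⟩ := hΨ.bound
  refine ⟨hΦ.contDiff.add hΨ.contDiff, N₁ + N₂, C₁ + C₂, by positivity, fun k hk x => ?_⟩
  have hkn : (k : WithTop ℕ∞) ≤ n := mod_cast hk
  have hx : (1 : ℝ) ≤ 1 + ‖x‖ := by linarith [norm_nonneg x]
  change ‖iteratedFDeriv ℝ k (Φ + Ψ) x‖ ≤ _
  rw [iteratedFDeriv_add (hΦ.contDiff.of_le hkn) (hΨ.contDiff.of_le hkn)]
  calc _ ≤ ‖iteratedFDeriv ℝ k Φ x‖ + ‖iteratedFDeriv ℝ k Ψ x‖ := norm_add_le _ _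
    _ ≤ C₁ * (1 + ‖x‖) ^ N₁ + C₂ * (1 + ‖x‖) ^ N₂ := add_le_add (h₁ k hk x) (h₂ k hk x)
    _ ≤ C₁ * (1 + ‖x‖) ^ (N₁ + N₂) + C₂ * (1 + ‖x‖) ^ (N₁ + N₂) := by
      gcongr <;> omega
    _ = _ := by ring

theorem sum {ι : Type*} (s : Finset ι) {Φ : ι → E → G} (h : ∀ i ∈ s, PolyContDiff n (Φ i)) :
    PolyContDiff n (fun x => ∑ i ∈ s, Φ i x) := by
  classical
  induction s using Finset.induction_on with
  | empty => simpa using const (0 : G)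
  | insert i s hi ih =>
    simp only [Finset.sum_insert hi]
    exact (h i (by simp)).add (ih fun j hj => h j (by simp [hj]))

theorem mul {Φ Ψ : E → ℝ} (hΦ : PolyContDiff n Φ) (hΨ : PolyContDiff n Ψ) :
    PolyContDiff n (fun x => Φ x * Ψ x) := by
  obtain ⟨N₁, C₁, hC₁, h₁⟩ := hΦ.bound
  obtain ⟨N₂, C₂, hC₂, h₂⟩ := hΨ.bound
  refine ⟨hΦ.contDiff.mul hΨ.contDiff, N₁ + N₂, 2 ^ n * (C₁ * C₂), by positivity,
    fun k hk x => ?_⟩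
  calc _ ≤ ∑ i ∈ Finset.range (k + 1), (k.choose i : ℝ) * ‖iteratedFDeriv ℝ i Φ x‖ *
        ‖iteratedFDeriv ℝ (k - i) Ψ x‖ :=
      norm_iteratedFDeriv_mul_le hΦ.contDiff hΨ.contDiff x (mod_cast hk)
    _ ≤ ∑ i ∈ Finset.range (k + 1), (k.choose i : ℝ) * (C₁ * (1 + ‖x‖) ^ N₁) *
        (C₂ * (1 + ‖x‖) ^ N₂) := by
      refine Finset.sum_le_sum fun i hi => ?_
      have hi : i ≤ k := Nat.lt_succ_iff.1 (Finset.mem_range.1 hi)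
      gcongr
      · exact h₁ i (hi.trans hk) x
      · exact h₂ (k - i) (by omega) x
    _ = 2 ^ k * (C₁ * C₂ * (1 + ‖x‖) ^ (N₁ + N₂)) := by
      rw [← Finset.sum_mul, ← Finset.sum_mul, ← Nat.cast_sum, Nat.sum_range_choose]
      push_cast
      ring
    _ ≤ 2 ^ n * (C₁ * C₂ * (1 + ‖x‖) ^ (N₁ + N₂)) := by
      gcongr
      norm_num
    _ = _ := by ring

theorem comp {Ψ : G → H} {Φ : E → G} (hΨ : PolyContDiff n Ψ) (hΦ : PolyContDiff n Φ) :
    PolyContDiff n (fun x => Ψ (Φ x)) := by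
  obtain ⟨N₁, C₁, hC₁, h₁⟩ := hΦ.bound
  obtain ⟨N₂, C₂, hC₂, h₂⟩ := hΨ.bound
  refine ⟨hΨ.contDiff.comp hΦ.contDiff, N₁ * (N₂ + n),
    n.factorial * (C₂ * (1 + C₁) ^ (N₂ + n)), by positivity, fun k hk x => ?_⟩
  set D : ℝ := (1 + C₁) * (1 + ‖x‖) ^ N₁ with hD
  have hA : 1 ≤ (1 + ‖x‖) ^ N₁ := one_le_pow₀ (by linarith [norm_nonneg x])
  have hD1 : 1 ≤ D := one_le_mul_of_one_le_of_one_le (by linarith) hA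
  have hΦx : 1 + ‖Φ x‖ ≤ D := by
    have := h₁ 0 (Nat.zero_le _) x
    rw [norm_iteratedFDeriv_zero] at this
    rw [hD]
    linarith
  calc _ ≤ k.factorial * (C₂ * D ^ N₂) * D ^ k := by
        refine norm_iteratedFDeriv_comp_le hΨ.contDiff hΦ.contDiff (mod_cast hk) x
          (fun i hi => ?_) (fun i hi hik => ?_)
        · refine (h₂ i (hi.trans hk) _).trans ?_
          gcongr
        · refine (h₁ i (hik.trans hk) x).trans ?_
          calc C₁ * (1 + ‖x‖) ^ N₁ ≤ D := by
                rw [hD]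
                gcongr
                exact le_add_of_nonneg_left zero_le_one
            _ ≤ D ^ i := le_self_pow₀ hD1 (by omega)
    _ ≤ n.factorial * (C₂ * D ^ N₂) * D ^ n := by
        gcongr
    _ = n.factorial * C₂ * D ^ (N₂ + n) := by ring
    _ = _ := by
        rw [hD, mul_pow, ← pow_mul]
        ring

theorem fderiv {Φ : E → G} (h : PolyContDiff (n + 1) Φ) : PolyContDiff n (fderiv ℝ Φ) := by
  obtain ⟨N, C, hC, hb⟩ := h.bound
  refine ⟨h.contDiff.fderiv_right (by norm_cast), N, C, hC, fun k hk x => ?_⟩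
  rw [norm_iteratedFDeriv_fderiv]
  exact hb (k + 1) (by omega) x

theorem exists_norm_le {Φ : E → G} (h : PolyContDiff n Φ) :
    ∃ (N : ℕ) (C : ℝ), 0 ≤ C ∧ ∀ x, ‖Φ x‖ ≤ C * (1 + ‖x‖) ^ N := by
  obtain ⟨N, C, hC, hb⟩ := h.bound
  exact ⟨N, C, hC, fun x => by simpa using hb 0 (Nat.zero_le _) x⟩

theorem of_iteratedDeriv {σ : ℝ → ℝ} (hσ : ContDiff ℝ n σ)
    (hb : ∀ j : ℕ, j ≤ n → ∃ C k : ℝ, 0 < C ∧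
      ∀ z : ℝ, |iteratedDeriv j σ z| ≤ C * (1 + z ^ 2) ^ k) : PolyContDiff n σ := by
  refine ⟨hσ, ?_⟩
  choose! C k hC hb using hb
  refine ⟨∑ j ∈ Finset.range (n + 1), 2 * ⌈k j⌉₊, ∑ j ∈ Finset.range (n + 1), |C j|,
    by positivity, fun j hj z => ?_⟩
  have hmem : j ∈ Finset.range (n + 1) := Finset.mem_range.2 (by omega)
  have h1 : (1 : ℝ) ≤ 1 + z ^ 2 := by nlinarith [sq_nonneg z]
  have h2 : (1 : ℝ) ≤ 1 + ‖z‖ := by linarith [norm_nonneg z]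
  rw [norm_iteratedFDeriv_eq_norm_iteratedDeriv, Real.norm_eq_abs]
  calc _ ≤ C j * (1 + z ^ 2) ^ k j := hb j hj z
    _ ≤ C j * (1 + z ^ 2) ^ (⌈k j⌉₊ : ℝ) :=
      mul_le_mul_of_nonneg_left (Real.rpow_le_rpow_of_exponent_le h1 (Nat.le_ceil _))
        (hC j hj).le
    _ = C j * (1 + z ^ 2) ^ ⌈k j⌉₊ := by rw [Real.rpow_natCast]
    _ ≤ C j * ((1 + ‖z‖) ^ 2) ^ ⌈k j⌉₊ := by
      have := (hC j hj).le
      gcongr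
      rw [← sq_abs z, Real.norm_eq_abs]
      nlinarith [abs_nonneg z]
    _ = C j * (1 + ‖z‖) ^ (2 * ⌈k j⌉₊) := by rw [pow_mul]
    _ ≤ (∑ j ∈ Finset.range (n + 1), |C j|) *
        (1 + ‖z‖) ^ ∑ j ∈ Finset.range (n + 1), 2 * ⌈k j⌉₊ := by
      gcongr
      · exact (le_abs_self _).trans
          (Finset.single_le_sum (f := fun j => |C j|) (fun _ _ => abs_nonneg _) hmem)
      · exact Finset.single_le_sum (f := fun j => 2 * ⌈k j⌉₊) (fun _ _ => Nat.zero_le _) hmem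

end PolyContDiff

theorem one_add_norm_prod_pow_le {P E : Type*} [NormedAddCommGroup P]
    [NormedAddCommGroup E] (p : P) (W : E) (N : ℕ) :
    (1 + ‖(p, W)‖) ^ N ≤ (1 + ‖p‖) ^ N * (1 + ‖W‖) ^ N := by
  rw [← mul_pow]
  gcongr
  have h : ‖(p, W)‖ ≤ ‖p‖ + ‖W‖ := by
    rw [Prod.norm_def]
    exact max_le_add_of_nonneg (norm_nonneg _) (norm_nonneg _)
  nlinarith [mul_nonneg (norm_nonneg p) (norm_nonneg W)]

section ParametricIntegral

universe u

variable {Ω P E : Type*} [MeasurableSpace Ω] {μ : Measure Ω}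
  [NormedAddCommGroup P] [NormedSpace ℝ P]
  {w : Ω → ℝ} {Z : Ω → P}

variable [NormedAddCommGroup E] [NormedSpace ℝ E]

theorem PolyContDiff.aestronglyMeasurable_weight_smul {G : Type*} [NormedAddCommGroup G]
    [NormedSpace ℝ G] {n : ℕ} {Φ : P × E → G} (hΦ : PolyContDiff n Φ)
    (hZ : AEStronglyMeasurable Z μ)
    (hw : ∀ N : ℕ, Integrable (fun ω => w ω * (1 + ‖Z ω‖) ^ N) μ) (W : E) :
    AEStronglyMeasurable (fun ω => w ω • Φ (Z ω, W)) μ := by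
  have hwm : AEStronglyMeasurable w μ := by simpa using (hw 0).aestronglyMeasurable
  have hc : Continuous fun p : P => Φ (p, W) := hΦ.contDiff.continuous.comp (by fun_prop)
  exact hwm.smul (hc.comp_aestronglyMeasurable hZ)

theorem PolyContDiff.exists_integrable_bound {G : Type*} [NormedAddCommGroup G]
    [NormedSpace ℝ G] {n : ℕ} {Φ : P × E → G} (hΦ : PolyContDiff n Φ)
    (hw : ∀ N : ℕ, Integrable (fun ω => w ω * (1 + ‖Z ω‖) ^ N) μ) (W₀ : E) :
    ∃ B : Ω → ℝ, Integrable B μ ∧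
      ∀ ω, ∀ W ∈ Metric.ball W₀ 1, ‖w ω • Φ (Z ω, W)‖ ≤ B ω := by
  obtain ⟨N, C, hC, hb⟩ := hΦ.exists_norm_le
  refine ⟨fun ω => ‖w ω * (1 + ‖Z ω‖) ^ N‖ * (C * (2 + ‖W₀‖) ^ N),
    (hw N).norm.mul_const _, fun ω W hW => ?_⟩
  have hWn : 1 + ‖W‖ ≤ 2 + ‖W₀‖ := by
    have := norm_le_norm_add_norm_sub W₀ W
    rw [mem_ball_iff_norm'] at hW
    linarith
  have hZn : ‖(1 + ‖Z ω‖) ^ N‖ = (1 + ‖Z ω‖) ^ N := Real.norm_of_nonneg (by positivity)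
  dsimp only
  rw [norm_smul, norm_mul, hZn]
  calc ‖w ω‖ * ‖Φ (Z ω, W)‖ ≤ ‖w ω‖ * (C * ((1 + ‖Z ω‖) ^ N * (1 + ‖W‖) ^ N)) := by
        gcongr
        exact (hb _).trans (by gcongr; exact one_add_norm_prod_pow_le _ _ _)
    _ ≤ ‖w ω‖ * (C * ((1 + ‖Z ω‖) ^ N * (2 + ‖W₀‖) ^ N)) := by gcongr
    _ = _ := by ring

theorem PolyContDiff.integrable_weight_smul {G : Type*} [NormedAddCommGroup G]
    [NormedSpace ℝ G] {n : ℕ} {Φ : P × E → G} (hΦ : PolyContDiff n Φ)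
    (hZ : AEStronglyMeasurable Z μ)
    (hw : ∀ N : ℕ, Integrable (fun ω => w ω * (1 + ‖Z ω‖) ^ N) μ) (W : E) :
    Integrable (fun ω => w ω • Φ (Z ω, W)) μ := by
  obtain ⟨B, hB, hb⟩ := hΦ.exists_integrable_bound hw W
  exact hB.mono' (hΦ.aestronglyMeasurable_weight_smul hZ hw W)
    (.of_forall fun ω => hb ω W (Metric.mem_ball_self one_pos))

/-- The partial derivative of `Φ` in its second argument. -/
noncomputable def fderivSnd {G : Type*} [NormedAddCommGroup G] [NormedSpace ℝ G]
    (Φ : P × E → G) (q : P × E) : E →L[ℝ] G :=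
  (fderiv ℝ Φ q).comp (ContinuousLinearMap.inr ℝ P E)

theorem PolyContDiff.fderivSnd {G : Type*} [NormedAddCommGroup G] [NormedSpace ℝ G] {n : ℕ}
    {Φ : P × E → G} (hΦ : PolyContDiff (n + 1) Φ) : PolyContDiff n (fderivSnd Φ) :=
  (PolyContDiff.clm
    ((ContinuousLinearMap.compL ℝ E (P × E) G).flip (ContinuousLinearMap.inr ℝ P E))).comp
    hΦ.fderiv

theorem hasFDerivAt_weight_smul {G : Type*} [NormedAddCommGroup G] [NormedSpace ℝ G] {n : ℕ}
    {Φ : P × E → G} (hΦ : PolyContDiff (n + 1) Φ) (c : ℝ) (p : P) (W : E) :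
    HasFDerivAt (fun W => c • Φ (p, W)) (c • fderivSnd Φ (p, W)) W := by
  have hd : HasFDerivAt Φ (_root_.fderiv ℝ Φ (p, W)) (p, W) :=
    (hΦ.contDiff.differentiable (by simp) _).hasFDerivAt
  exact (hd.comp W (hasFDerivAt_prodMk_right p W)).const_smul c

theorem PolyContDiff.hasFDerivAt_integral {G : Type*} [NormedAddCommGroup G]
    [NormedSpace ℝ G] {n : ℕ} {Φ : P × E → G} (hΦ : PolyContDiff (n + 1) Φ)
    (hZ : AEStronglyMeasurable Z μ)
    (hw : ∀ N : ℕ, Integrable (fun ω => w ω * (1 + ‖Z ω‖) ^ N) μ) (W : E) :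
    HasFDerivAt (fun W => ∫ ω, w ω • Φ (Z ω, W) ∂μ)
      (∫ ω, w ω • _root_.fderivSnd Φ (Z ω, W) ∂μ) W := by
  obtain ⟨B, hB, hb⟩ := hΦ.fderivSnd.exists_integrable_bound hw W
  exact hasFDerivAt_integral_of_dominated_of_fderiv_le (Metric.ball_mem_nhds W one_pos)
    (.of_forall fun W => hΦ.aestronglyMeasurable_weight_smul hZ hw W)
    (hΦ.integrable_weight_smul hZ hw W)
    (hΦ.fderivSnd.aestronglyMeasurable_weight_smul hZ hw W)
    (.of_forall hb) hB
    (.of_forall fun ω W _ => hasFDerivAt_weight_smul hΦ _ _ _)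

theorem PolyContDiff.contDiff_integral {P E G : Type u} [NormedAddCommGroup P]
    [NormedSpace ℝ P] [NormedAddCommGroup E] [NormedSpace ℝ E] [NormedAddCommGroup G]
    [NormedSpace ℝ G] {Z : Ω → P} {n : ℕ} {Φ : P × E → G} (hΦ : PolyContDiff n Φ)
    (hZ : AEStronglyMeasurable Z μ)
    (hw : ∀ N : ℕ, Integrable (fun ω => w ω * (1 + ‖Z ω‖) ^ N) μ) :
    ContDiff ℝ n (fun W => ∫ ω, w ω • Φ (Z ω, W) ∂μ) := by
  induction n generalizing G with
  | zero =>
    rw [Nat.cast_zero, contDiff_zero, continuous_iff_continuousAt]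
    intro W
    obtain ⟨B, hB, hb⟩ := hΦ.exists_integrable_bound hw W
    refine continuousAt_of_dominated
      (.of_forall fun W => hΦ.aestronglyMeasurable_weight_smul hZ hw W)
      (Filter.eventually_of_mem (Metric.ball_mem_nhds W one_pos)
        fun V hV => .of_forall fun ω => hb ω V hV) hB (.of_forall fun ω => ?_)
    have hc : Continuous fun V : E => Φ (Z ω, V) := hΦ.contDiff.continuous.comp (by fun_prop)
    exact (hc.const_smul (w ω)).continuousAt
  | succ n ih =>
    push_cast
    rw [contDiff_succ_iff_hasFDerivAt]
    exact ⟨_, ih hΦ.fderivSnd, hΦ.hasFDerivAt_integral hZ hw⟩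

end ParametricIntegral

section DiffUnderIntegral

variable {Ω E : Type*} [MeasurableSpace Ω] [NormedAddCommGroup E] [NormedSpace ℝ E]

/-- The expectation of the random function `g` is `n` times continuously differentiable, and its
derivative is the expectation of the derivative of `g`. -/
structure DiffUnderIntegral (μ : Measure Ω) (n : ℕ) (g : Ω → E → ℝ) : Prop where
  contDiff : ContDiff ℝ n (fun W => ∫ ω, g ω W ∂μ)
  integrable : ∀ W, Integrable (fun ω => g ω W) μ
  differentiable : ∀ ω, Differentiable ℝ (g ω)
  integrable_fderiv : ∀ W, Integrable (fun ω => fderiv ℝ (g ω) W) μ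
  hasFDerivAt : ∀ W, HasFDerivAt (fun W => ∫ ω, g ω W ∂μ) (∫ ω, fderiv ℝ (g ω) W ∂μ) W

theorem integrable_fun_add {V : Type*} [NormedAddCommGroup V] {μ : Measure Ω} {f g : Ω → V}
    (hf : Integrable f μ) (hg : Integrable g μ) : Integrable (fun ω => f ω + g ω) μ :=
  hf.add hg

theorem integrable_zero_fun {V : Type*} [NormedAddCommGroup V] {μ : Measure Ω} :
    Integrable (fun _ : Ω => (0 : V)) μ :=
  integrable_zero _ _ _

namespace DiffUnderIntegral

variable {μ : Measure Ω} {n : ℕ} {g h : Ω → E → ℝ}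

theorem add (hg : DiffUnderIntegral μ n g) (hh : DiffUnderIntegral μ n h) :
    DiffUnderIntegral μ n (fun ω W => g ω W + h ω W) := by
  have hint : (fun W => ∫ ω, g ω W + h ω W ∂μ) =
      fun W => (∫ ω, g ω W ∂μ) + ∫ ω, h ω W ∂μ :=
    funext fun W => integral_add (hg.integrable W) (hh.integrable W)
  have hfd : ∀ W ω, fderiv ℝ (fun W => g ω W + h ω W) W =
      fderiv ℝ (g ω) W + fderiv ℝ (h ω) W := fun W ω =>
    fderiv_fun_add (hg.differentiable ω W) (hh.differentiable ω W)
  refine ⟨?_, fun W => (hg.integrable W).add (hh.integrable W),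
    fun ω => (hg.differentiable ω).add (hh.differentiable ω), fun W => ?_, fun W => ?_⟩
  · rw [hint]
    exact hg.contDiff.add hh.contDiff
  · simp only [hfd]
    exact integrable_fun_add (hg.integrable_fderiv W) (hh.integrable_fderiv W)
  · simp only [hfd]
    rw [hint, integral_add (hg.integrable_fderiv W) (hh.integrable_fderiv W)]
    exact (hg.hasFDerivAt W).add (hh.hasFDerivAt W)

theorem zero : DiffUnderIntegral μ n (fun _ _ => 0 : Ω → E → ℝ) :=
  ⟨by simpa using contDiff_const, fun _ => integrable_zero _ _ _, by simp,
    fun W => by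
      simp only [fderiv_fun_const]
      exact integrable_zero_fun, fun W => by simpa using hasFDerivAt_const (0 : ℝ) W⟩

theorem sum {ι : Type*} (s : Finset ι) {g : ι → Ω → E → ℝ}
    (hg : ∀ i ∈ s, DiffUnderIntegral μ n (g i)) :
    DiffUnderIntegral μ n (fun ω W => ∑ i ∈ s, g i ω W) := by
  classical
  induction s using Finset.induction_on with
  | empty => simpa using zero
  | insert i s hi ih =>
    simp only [Finset.sum_insert hi]
    exact (hg i (by simp)).add (ih fun j hj => hg j (by simp [hj]))

theorem of_polyContDiff {P E : Type} [NormedAddCommGroup P] [NormedSpace ℝ P]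
    [NormedAddCommGroup E] [NormedSpace ℝ E] {w : Ω → ℝ} {Z : Ω → P} {Φ : P × E → ℝ}
    (hΦ : PolyContDiff (n + 1) Φ) (hZ : AEStronglyMeasurable Z μ)
    (hw : ∀ N : ℕ, Integrable (fun ω => w ω * (1 + ‖Z ω‖) ^ N) μ) :
    DiffUnderIntegral μ n (fun ω W => w ω * Φ (Z ω, W)) := by
  have hfd : ∀ ω W, HasFDerivAt (fun W => w ω * Φ (Z ω, W)) (w ω • fderivSnd Φ (Z ω, W)) W :=
    fun ω W => hasFDerivAt_weight_smul hΦ (w ω) (Z ω) W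
  refine ⟨(hΦ.of_le n.le_succ).contDiff_integral hZ hw, hΦ.integrable_weight_smul hZ hw,
    fun ω W => (hfd ω W).differentiableAt, fun W => ?_, fun W => ?_⟩
  · simp only [(hfd _ W).fderiv]
    exact hΦ.fderivSnd.integrable_weight_smul hZ hw W
  · simp only [(hfd _ W).fderiv]
    exact hΦ.hasFDerivAt_integral hZ hw W

theorem deriv_comp (hg : DiffUnderIntegral μ n g) {γ : ℝ → E} {t : ℝ}
    (hγ : DifferentiableAt ℝ γ t) :
    deriv (fun s => ∫ ω, g ω (γ s) ∂μ) t = ∫ ω, deriv (fun s => g ω (γ s)) t ∂μ := by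
  have hω : ∀ ω, deriv (fun s => g ω (γ s)) t = fderiv ℝ (g ω) (γ t) (deriv γ t) := fun ω =>
    ((hg.differentiable ω _).hasFDerivAt.comp_hasDerivAt t hγ.hasDerivAt).deriv
  simp only [hω]
  rw [← ContinuousLinearMap.integral_apply (hg.integrable_fderiv _)]
  exact ((hg.hasFDerivAt _).comp_hasDerivAt t hγ.hasDerivAt).deriv

end DiffUnderIntegral

end DiffUnderIntegral

section Network

variable {d : ℕ → ℕ} {L : ℕ}

theorem abs_apply_le_l2norm {m : ℕ} (v : Fin m → ℝ) (i : Fin m) : |v i| ≤ l2norm v := by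
  rw [l2norm, ← Real.sqrt_sq_eq_abs]
  exact Real.sqrt_le_sqrt
    (Finset.single_le_sum (f := fun i => v i ^ 2) (fun _ _ => sq_nonneg _) (Finset.mem_univ i))

theorem norm_le_l2norm {m : ℕ} (v : Fin m → ℝ) : ‖v‖ ≤ l2norm v :=
  (pi_norm_le_iff_of_nonneg (Real.sqrt_nonneg _)).2 (abs_apply_le_l2norm v)

theorem mask_mul_extendW (f : ∀ i : ℕ, Fin (d (i + 1)) → Fin (d i) → ℝ)
    (W : ∀ i : Fin L, Fin (d (i.1 + 1)) → Fin (d i.1) → ℝ) :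
    (fun i a b => f i a b * extendW d L W i a b) =
      extendW d L (fun i a b => f i.1 a b * W i a b) := by
  funext i a b
  by_cases h : i < L <;> simp [extendW, h]

theorem entryUpdate_extendW (W : ∀ i : Fin L, Fin (d (i.1 + 1)) → Fin (d i.1) → ℝ)
    (i : Fin L) (a : Fin (d (i.1 + 1))) (b : Fin (d i.1)) (t : ℝ) :
    entryUpdate d (extendW d L W) i.1 a b t = extendW d L (Function.update W i
      (Function.update (W i) a (Function.update (W i a) b t))) := by
  have hi : extendW d L W i.1 = W i := by simp [extendW]
  funext j
  rw [entryUpdate, hi]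
  by_cases hj : j = i.1
  · subst hj
    simp [extendW]
  · rw [Function.update_of_ne hj]
    by_cases h : j < L
    · have hne : (⟨j, h⟩ : Fin L) ≠ i := fun e => hj (congrArg Fin.val e)
      simp [extendW, h, Function.update_of_ne hne]
    · simp [extendW, h]

theorem differentiable_update_entry (W : ∀ i : Fin L, Fin (d (i.1 + 1)) → Fin (d i.1) → ℝ)
    (i : Fin L) (a : Fin (d (i.1 + 1))) (b : Fin (d i.1)) :
    Differentiable ℝ (fun t : ℝ => Function.update W i
      (Function.update (W i) a (Function.update (W i a) b t))) := by
  have h₁ : Differentiable ℝ (Function.update W i) := fun V =>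
    (hasFDerivAt_update W V).differentiableAt
  have h₂ : Differentiable ℝ (Function.update (W i) a) := fun v =>
    (hasFDerivAt_update (W i) v).differentiableAt
  have h₃ : Differentiable ℝ (Function.update (W i a) b) := fun t =>
    (hasFDerivAt_update (W i a) t).differentiableAt
  exact h₁.comp (h₂.comp h₃)

theorem mask_mul_pderivEntry_dropLoss (σ : ℝ → ℝ)
    (f : ∀ i : ℕ, Fin (d (i + 1)) → Fin (d i) → ℝ) (x : Fin (d 0) → ℝ) (y : Fin (d L) → ℝ)
    (W : ∀ i : ℕ, Fin (d (i + 1)) → Fin (d i) → ℝ)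
    (i : ℕ) (a : Fin (d (i + 1))) (b : Fin (d i)) (hf : f i a b = 0 ∨ f i a b = 1) :
    f i a b * pderivEntry d (dropLoss σ d L f x y) W i a b =
      pderivEntry d (dropLoss σ d L f x y) W i a b := by
  rcases hf with hf | hf
  · have hmask : ∀ t, (fun j a' b' => f j a' b' * entryUpdate d W i a b t j a' b') =
        fun j a' b' => f j a' b' * W j a' b' := by
      intro t
      funext j a' b'
      by_cases hj : j = i
      · subst hj
        by_cases ha : a' = a
        · subst ha
          by_cases hb : b' = b
          · subst hb
            simp [hf]
          · simp [entryUpdate, hb]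
        · simp [entryUpdate, ha]
      · simp [entryUpdate, hj]
    have hconst : pderivEntry d (dropLoss σ d L f x y) W i a b = 0 := by
      simp only [pderivEntry, dropLoss, hmask, deriv_const]
    rw [hconst, mul_zero]
  · rw [hf, one_mul]

/-- Weight tuples of an `L`-layer network. -/
abbrev Weights (d : ℕ → ℕ) (L : ℕ) : Type :=
  ∀ i : Fin L, Fin (d (i.1 + 1)) → Fin (d i.1) → ℝ

/-- The masked weights, as a function of masks, input and weights. -/
noncomputable def maskedW (q : (Weights d L × (Fin (d 0) → ℝ)) × Weights d L) :
    ∀ i : ℕ, Fin (d (i + 1)) → Fin (d i) → ℝ :=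
  extendW d L (fun i a b => q.1.1 i a b * q.2 i a b)

theorem polyContDiff_maskedW (n i : ℕ) (a : Fin (d (i + 1))) (b : Fin (d i)) :
    PolyContDiff n
      (fun q : (Weights d L × (Fin (d 0) → ℝ)) × Weights d L => maskedW q i a b) := by
  by_cases h : i < L
  · simp only [maskedW, extendW, h, dif_pos]
    let entry : Weights d L →L[ℝ] ℝ :=
      (ContinuousLinearMap.proj (R := ℝ) (φ := fun _ : Fin (d i) => ℝ) b).comp
        ((ContinuousLinearMap.proj (R := ℝ) (φ := fun _ : Fin (d (i + 1)) => Fin (d i) → ℝ)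
          a).comp (ContinuousLinearMap.proj (R := ℝ)
            (φ := fun j : Fin L => Fin (d (j.1 + 1)) → Fin (d j.1) → ℝ) ⟨i, h⟩))
    exact (PolyContDiff.clm (entry.comp
      ((ContinuousLinearMap.fst ℝ (Weights d L) (Fin (d 0) → ℝ)).comp
        (ContinuousLinearMap.fst ℝ (Weights d L × (Fin (d 0) → ℝ)) (Weights d L))))).mul
      (PolyContDiff.clm (entry.comp
        (ContinuousLinearMap.snd ℝ (Weights d L × (Fin (d 0) → ℝ)) (Weights d L))))
  · simp only [maskedW, extendW, h, dif_neg, not_false_eq_true]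
    exact PolyContDiff.const 0

theorem polyContDiff_hiddenLayer {n : ℕ} {σ : ℝ → ℝ} (hσ : PolyContDiff n σ) (i : ℕ)
    (a : Fin (d i)) :
    PolyContDiff n (fun q : (Weights d L × (Fin (d 0) → ℝ)) × Weights d L =>
      hiddenLayer σ d (maskedW q) q.1.2 i a) := by
  induction i with
  | zero =>
    exact PolyContDiff.clm ((ContinuousLinearMap.proj (φ := fun _ => ℝ) a).comp
      ((ContinuousLinearMap.snd ℝ (Weights d L) (Fin (d 0) → ℝ)).comp
        (ContinuousLinearMap.fst ℝ (Weights d L × (Fin (d 0) → ℝ)) (Weights d L))))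
  | succ i ih =>
    exact hσ.comp (PolyContDiff.sum _ fun b _ => (polyContDiff_maskedW n i a b).mul (ih b))

theorem polyContDiff_netOut {n : ℕ} {σ : ℝ → ℝ} (hσ : PolyContDiff n σ) (m : ℕ)
    (a : Fin (d m)) :
    PolyContDiff n (fun q : (Weights d L × (Fin (d 0) → ℝ)) × Weights d L =>
      netOut σ d (maskedW q) q.1.2 m a) := by
  cases m with
  | zero => exact polyContDiff_hiddenLayer hσ 0 a
  | succ m =>
    exact PolyContDiff.sum _ fun b _ =>
      (polyContDiff_maskedW n m a b).mul (polyContDiff_hiddenLayer hσ m b)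

theorem integrable_weight_mul_one_add_norm_pow {Ω : Type*} [MeasurableSpace Ω] {μ : Measure Ω}
    {F : Ω → ∀ i : ℕ, Fin (d (i + 1)) → Fin (d i) → ℝ}
    {X : Ω → Fin (d 0) → ℝ} {Y : Ω → Fin (d L) → ℝ}
    (hF01 : ∀ ω i a b, F ω i a b = 0 ∨ F ω i a b = 1)
    {Z : Ω → Weights d L × (Fin (d 0) → ℝ)} (hZdef : ∀ ω, Z ω = (fun i : Fin L => F ω i.1, X ω))
    (hZ : AEStronglyMeasurable Z μ) {m : ℕ}
    (hmom : ∀ n : ℕ, Integrable (fun ω => l2norm (Y ω) ^ m * l2norm (X ω) ^ n) μ)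
    {w : Ω → ℝ} (hw : AEStronglyMeasurable w μ) {c : ℝ}
    (hwle : ∀ ω, |w ω| ≤ c * l2norm (Y ω) ^ m) (N : ℕ) :
    Integrable (fun ω => w ω * (1 + ‖Z ω‖) ^ N) μ := by
  have hbd : Integrable (fun ω => c * (2 ^ (N - 1) * (2 ^ N * (l2norm (Y ω) ^ m *
      l2norm (X ω) ^ 0) + l2norm (Y ω) ^ m * l2norm (X ω) ^ N))) μ :=
    ((((hmom 0).const_mul _).add (hmom N)).const_mul _).const_mul _
  refine hbd.mono' (hw.mul ((hZ.norm.const_add 1).pow N)) (.of_forall fun ω => ?_)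
  have hx : 0 ≤ l2norm (X ω) := Real.sqrt_nonneg _
  have hmask : ‖(fun i => F ω i.1 : Weights d L)‖ ≤ 1 := by
    simp only [pi_norm_le_iff_of_nonneg zero_le_one]
    intro i a b
    rcases hF01 ω i.1 a b with h | h <;> simp [h]
  have hZn : 1 + ‖Z ω‖ ≤ 2 + l2norm (X ω) := by
    have : ‖Z ω‖ ≤ 1 + l2norm (X ω) := by
      rw [hZdef, Prod.norm_def]
      exact max_le (hmask.trans (by linarith)) ((norm_le_l2norm _).trans (by linarith))
    linarith
  have hp : ‖(1 + ‖Z ω‖) ^ N‖ = (1 + ‖Z ω‖) ^ N := Real.norm_of_nonneg (by positivity)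
  rw [norm_mul, hp, Real.norm_eq_abs]
  calc |w ω| * (1 + ‖Z ω‖) ^ N ≤ c * l2norm (Y ω) ^ m * (2 + l2norm (X ω)) ^ N := by
        gcongr
        · exact (abs_nonneg _).trans (hwle ω)
        · exact hwle ω
    _ ≤ c * l2norm (Y ω) ^ m * (2 ^ (N - 1) * (2 ^ N + l2norm (X ω) ^ N)) := by
        gcongr
        · exact (abs_nonneg _).trans (hwle ω)
        · exact add_pow_le zero_le_two hx N
    _ = _ := by ring

theorem diffUnderIntegral_dropLoss {n : ℕ} {σ : ℝ → ℝ} (hσ : PolyContDiff (n + 1) σ)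
    {Ω : Type*} [MeasurableSpace Ω] {μ : Measure Ω}
    {F : Ω → ∀ i : ℕ, Fin (d (i + 1)) → Fin (d i) → ℝ}
    {X : Ω → Fin (d 0) → ℝ} {Y : Ω → Fin (d L) → ℝ}
    (hF01 : ∀ ω i a b, F ω i a b = 0 ∨ F ω i a b = 1)
    (hFmeas : Measurable F) (hXmeas : Measurable X) (hYmeas : Measurable Y)
    (hmom : ∀ m n : ℕ, m ≤ 2 →
      Integrable (fun ω => l2norm (Y ω) ^ m * l2norm (X ω) ^ n) μ) :
    DiffUnderIntegral μ n (fun ω (W : Weights d L) =>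
      dropLoss σ d L (F ω) (X ω) (Y ω) (extendW d L W)) := by
  let Z : Ω → Weights d L × (Fin (d 0) → ℝ) := fun ω => (fun i => F ω i.1, X ω)
  have hZ : AEStronglyMeasurable Z μ := by
    have h1 : Measurable fun ω => (fun i => F ω i.1 : Weights d L) :=
      measurable_pi_lambda _ fun i => (measurable_pi_apply i.1).comp hFmeas
    exact (h1.prodMk hXmeas).aestronglyMeasurable
  have hint : ∀ {m : ℕ} {w : Ω → ℝ} {c : ℝ}, m ≤ 2 → Measurable w →
      (∀ ω, |w ω| ≤ c * l2norm (Y ω) ^ m) →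
      ∀ N : ℕ, Integrable (fun ω => w ω * (1 + ‖Z ω‖) ^ N) μ := fun hm hw hwle =>
    integrable_weight_mul_one_add_norm_pow hF01 (fun _ => rfl) hZ (fun N => hmom _ N hm)
      hw.aestronglyMeasurable hwle
  have hexpand : (fun ω (W : Weights d L) =>
      dropLoss σ d L (F ω) (X ω) (Y ω) (extendW d L W)) = fun ω W => ∑ a,
        (1 * (netOut σ d (maskedW (Z ω, W)) (Z ω, W).1.2 L a *
            netOut σ d (maskedW (Z ω, W)) (Z ω, W).1.2 L a) +
          -2 * Y ω a * netOut σ d (maskedW (Z ω, W)) (Z ω, W).1.2 L a + Y ω a ^ 2 * 1) := by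
    funext ω W
    rw [dropLoss, mask_mul_extendW]
    refine Finset.sum_congr rfl fun a _ => ?_
    change (netOut σ d (maskedW (Z ω, W)) (Z ω, W).1.2 L a - _) ^ 2 = _
    ring
  rw [hexpand]
  refine DiffUnderIntegral.sum _ fun a _ => ?_
  have hnet := polyContDiff_netOut (d := d) (L := L) hσ L a
  have hYa : Measurable fun ω => Y ω a := (measurable_pi_apply a).comp hYmeas
  refine ((DiffUnderIntegral.of_polyContDiff (hnet.mul hnet) hZ
      (hint (m := 0) (c := 1) (by norm_num) measurable_const ?_)).add
    (DiffUnderIntegral.of_polyContDiff hnet hZ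
      (hint (m := 1) (c := 2) (by norm_num) (hYa.const_mul _) ?_))).add
    (DiffUnderIntegral.of_polyContDiff (PolyContDiff.const 1) hZ
      (hint (m := 2) (c := 1) le_rfl (hYa.pow_const 2) ?_))
  · intro ω
    simp
  · intro ω
    rw [abs_mul, pow_one]
    norm_num [abs_apply_le_l2norm]
  · intro ω
    rw [abs_pow, one_mul]
    exact pow_le_pow_left₀ (abs_nonneg _) (abs_apply_le_l2norm _ _) 2

end Network

/-- If `σ` is `r` times continuously differentiable with polynomially
bounded derivatives `σ⁽ʲ⁾` for `0 ≤ j ≤ r`, the masks take values in `{0,1}`, and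
`E[‖Y‖₂^m ‖X‖₂^n] < ∞` for `m ≤ 2`, `n ∈ ℕ`, then the dropout risk
`𝒟(W) = E[l(Ψ_{F⊙W}(X), Y)]` is `(r−1)` times continuously differentiable and its gradient
satisfies `∇𝒟(W) = E[F ⊙ ∇_W l(Ψ_{F⊙W}(X), Y)]` (derivative and expectation may be
exchanged). -/
theorem statement5 (L r : ℕ) (hL : 1 ≤ L) (hr : 1 ≤ r) (d : ℕ → ℕ)
    (σ : ℝ → ℝ) (hσdiff : ContDiff ℝ r σ)
    (hσpoly : ∀ j : ℕ, j ≤ r → ∃ C k : ℝ, 0 < C ∧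
      ∀ z : ℝ, |iteratedDeriv j σ z| ≤ C * (1 + z ^ 2) ^ k)
    {Ω : Type*} [MeasurableSpace Ω] (μ : Measure Ω) [IsProbabilityMeasure μ]
    (F : Ω → ∀ i : ℕ, Fin (d (i + 1)) → Fin (d i) → ℝ)
    (X : Ω → Fin (d 0) → ℝ) (Y : Ω → Fin (d L) → ℝ)
    (hF01 : ∀ ω i a b, F ω i a b = 0 ∨ F ω i a b = 1)
    (hFmeas : Measurable F) (hXmeas : Measurable X) (hYmeas : Measurable Y)
    (hmom : ∀ m n : ℕ, m ≤ 2 →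
      Integrable (fun ω => l2norm (Y ω) ^ m * l2norm (X ω) ^ n) μ) :
    ContDiff ℝ (r - 1 : ℕ) (dropRisk σ d L μ F X Y) ∧
      ∀ (W : ∀ i : Fin L, Fin (d (i.1 + 1)) → Fin (d i.1) → ℝ)
        (i : Fin L) (a : Fin (d (i.1 + 1))) (b : Fin (d i.1)),
        pderivFin d L (dropRisk σ d L μ F X Y) W i a b =
          ∫ ω, F ω i.1 a b *
            pderivEntry d (dropLoss σ d L (F ω) (X ω) (Y ω)) (extendW d L W) i.1 a b ∂μ := by
  obtain ⟨n, rfl⟩ : ∃ n, r = n + 1 := ⟨r - 1, by omega⟩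
  have hD := diffUnderIntegral_dropLoss (L := L) (.of_iteratedDeriv hσdiff hσpoly) hF01 hFmeas
    hXmeas hYmeas hmom
  refine ⟨hD.contDiff, fun W i a b => ?_⟩
  have hWi : extendW d L W i.1 a b = W i a b := by simp [extendW]
  calc _ = _ := hD.deriv_comp (differentiable_update_entry W i a b (W i a b))
    _ = _ := integral_congr_ae (.of_forall fun ω => ?_)
  dsimp only
  rw [mask_mul_pderivEntry_dropLoss _ _ _ _ _ _ _ _ (hF01 ω i.1 a b), pderivEntry, hWi]
  simp only [entryUpdate_extendW]
end

section
/- Let n ≥ 1 and let f : ℝⁿ → ℝ be n times continuously differentiable. Then f is constant on every connected subset of its critical set Crit(f) = {x ∈ ℝⁿ : ∇f(x) = 0}; that is, if S ⊆ Crit(f) is connected, then f(a) = f(b) for all a, b ∈ S. -/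
open Set Filter Topology MeasureTheory Asymptotics Metric
open scoped NNReal ENNReal

section Calculus

variable {E F G : Type*} [NormedAddCommGroup E] [NormedSpace ℝ E] [NormedAddCommGroup F]
  [NormedSpace ℝ F] [NormedAddCommGroup G] [NormedSpace ℝ G]

/-- If `f` is differentiable near `a` and `Df(x) = o(‖x - a‖ ^ k)` as `x → a`, then
`f x - f a = o(‖x - a‖ ^ (k + 1))`. -/
theorem sub_isLittleO_norm_pow_succ_of_fderiv {f : E → F} {a : E} {k : ℕ}
    (hdf : ∀ᶠ x in 𝓝 a, DifferentiableAt ℝ f x)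
    (hderiv : fderiv ℝ f =o[𝓝 a] fun x => ‖x - a‖ ^ k) :
    (fun x => f x - f a) =o[𝓝 a] fun x => ‖x - a‖ ^ (k + 1) := by
  refine isLittleO_iff.2 fun c hc => ?_
  rcases eventually_nhds_iff_ball.mp (hdf.and (isLittleO_iff.1 hderiv hc)) with ⟨ε, hε₀, hε⟩
  rw [eventually_nhds_iff_ball]
  refine ⟨ε, hε₀, fun y hy ↦ ?_⟩
  rw [Real.norm_of_nonneg (by positivity), pow_succ, ← mul_assoc]
  have hsub : closedBall a ‖y - a‖ ⊆ ball a ε :=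
    closedBall_subset_ball (mem_ball_iff_norm.mp hy)
  apply (convex_closedBall a ‖y - a‖).norm_image_sub_le_of_norm_fderiv_le (𝕜 := ℝ)
  · exact fun z hz ↦ (hε z <| hsub hz).1
  · intro z hz
    grw [(hε z <| hsub hz).2, Real.norm_of_nonneg (by positivity), mem_closedBall_iff_norm.mp hz]
  · simp
  · simp [dist_eq_norm_sub]

/-- If `ψ` is `C¹` at `y` and `Dg(ψ x) = o(‖x - y‖ ^ k)` as `x → y`, then
`g (ψ x) - g (ψ y) = o(‖x - y‖ ^ (k + 1))`. -/
theorem comp_sub_isLittleO_norm_pow_succ_of_fderiv {ψ : E → F} {g : F → G} {y : E} {k : ℕ}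
    (hψ : ContDiffAt ℝ 1 ψ y) (hg : ∀ᶠ z in 𝓝 (ψ y), DifferentiableAt ℝ g z)
    (hderiv : (fun x => fderiv ℝ g (ψ x)) =o[𝓝 y] fun x => ‖x - y‖ ^ k) :
    (fun x => g (ψ x) - g (ψ y)) =o[𝓝 y] fun x => ‖x - y‖ ^ (k + 1) := by
  have hψd : ∀ᶠ x in 𝓝 y, DifferentiableAt ℝ ψ x :=
    (hψ.eventually (by simp)).mono fun x hx => hx.differentiableAt (by simp)
  have hgψ : ∀ᶠ x in 𝓝 y, DifferentiableAt ℝ g (ψ x) := hψ.continuousAt.eventually hg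
  refine sub_isLittleO_norm_pow_succ_of_fderiv (f := fun x => g (ψ x)) ?_ ?_
  · filter_upwards [hψd, hgψ] with x h1 h2 using h2.comp x h1
  · have hbd : (fun x => fderiv ℝ ψ x) =O[𝓝 y] fun _ => (1 : ℝ) :=
      ((hψ.fderiv_right (m := 0) (by simp)).continuousAt).isBigO_one ℝ
    have hprod : (fun x => ‖fderiv ℝ g (ψ x)‖ * ‖fderiv ℝ ψ x‖) =o[𝓝 y]
        fun x => ‖x - y‖ ^ k := by
      simpa using hderiv.norm_left.mul_isBigO hbd.norm_left
    refine IsBigO.trans_isLittleO (IsBigO.of_bound 1 ?_) hprod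
    filter_upwards [hψd, hgψ] with x h1 h2
    rw [show fderiv ℝ (fun x => g (ψ x)) x = _ from fderiv_comp x h2 h1, one_mul,
      Real.norm_of_nonneg (by positivity)]
    exact ContinuousLinearMap.opNorm_comp_le _ _

/-- Near a point at which a `C^k` function `g` (`k ≥ 1`) has nonzero derivative `L`, the zero set
of `g` is parametrized by the hyperplane `ker L` through a `C^k` local diffeomorphism. -/
theorem exists_contDiffAt_straightening [CompleteSpace E] {g : E → ℝ} {x₀ : E} {k : ℕ}
    (hk : k ≠ 0) (hg : ContDiffAt ℝ k g x₀) (hL : fderiv ℝ g x₀ ≠ 0) :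
    ∃ V ∈ 𝓝 x₀, ∃ Φ φ : E → E, (∀ x ∈ V, φ (Φ x) = x) ∧
      (∀ x ∈ V, ContDiffAt ℝ k φ (Φ x)) ∧ ∀ x, g x = 0 → fderiv ℝ g x₀ (Φ x) = 0 := by
  set L := fderiv ℝ g x₀ with hLdef
  obtain ⟨v, hv⟩ : ∃ v, L v = 1 := by
    obtain ⟨w, hw⟩ : ∃ w, L w ≠ 0 := by
      by_contra! h
      exact hL (ContinuousLinearMap.ext h)
    exact ⟨(L w)⁻¹ • w, by simp [hw]⟩
  have hk' : (k : WithTop ℕ∞) ≠ 0 := by exact_mod_cast hk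
  let Φ : E → E := fun x => x + (g x - L x) • v
  have hΦ : ContDiffAt ℝ k Φ x₀ :=
    contDiffAt_id.add ((hg.sub L.contDiff.contDiffAt).smul contDiffAt_const)
  have hΦ' : HasFDerivAt Φ ((ContinuousLinearEquiv.refl ℝ E : E ≃L[ℝ] E) : E →L[ℝ] E) x₀ := by
    have h1 : HasFDerivAt g L x₀ := (hg.differentiableAt hk').hasFDerivAt
    have h2 := (hasFDerivAt_id x₀).add ((h1.sub L.hasFDerivAt).smul_const v)
    convert! h2 using 1
    ext x
    simp
  let φ := hΦ.localInverse hΦ' hk'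
  have hφ : ContDiffAt ℝ k φ (Φ x₀) := hΦ.to_localInverse hΦ' hk'
  have hinv : ∀ᶠ x in 𝓝 x₀, φ (Φ x) = x :=
    (hΦ.hasStrictFDerivAt' hΦ' hk').eventually_left_inverse
  have hsmooth : ∀ᶠ x in 𝓝 x₀, ContDiffAt ℝ k φ (Φ x) :=
    hΦ.continuousAt.eventually (hφ.eventually (by simp))
  refine ⟨_, hinv.and hsmooth, Φ, φ, fun x hx => hx.1, fun x hx => hx.2, fun x hx => ?_⟩
  simp [Φ, hx, hv]

end Calculus

section MorseDecomposition

/-- `B` is contained in the image of a set `s ⊆ ℝᵐ`, `m ≤ n`, under a map `ψ` which is `C¹` at the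
points of `s`, takes `s` into `A`, and is such that every `C^k` function vanishing on `A` vanishes
to order `o(‖x - y‖ ^ k)` along `ψ` at every point `y` of `s`. -/
def IsMorseChart {E : Type} [NormedAddCommGroup E] [NormedSpace ℝ E] (n k : ℕ) (A B : Set E) :
    Prop :=
  ∃ m ≤ n, ∃ (ψ : EuclideanSpace ℝ (Fin m) → E) (s : Set (EuclideanSpace ℝ (Fin m))),
    B ⊆ ψ '' s ∧ MapsTo ψ s A ∧ (∀ y ∈ s, ContDiffAt ℝ 1 ψ y) ∧
    ∀ (G : Type) [NormedAddCommGroup G] [NormedSpace ℝ G] (g : E → G),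
      (∀ x ∈ A, ContDiffAt ℝ k g x) → (∀ x ∈ A, g x = 0) →
      ∀ y ∈ s, (fun x => g (ψ x)) =o[𝓝 y] fun x => ‖x - y‖ ^ k

/-- `B` is covered by countably many sets that are Morse charts relative to `A`. -/
def IsMorseCovered {E : Type} [NormedAddCommGroup E] [NormedSpace ℝ E] (n k : ℕ) (A B : Set E) :
    Prop :=
  ∃ 𝓑 : Set (Set E), 𝓑.Countable ∧ (∀ C ∈ 𝓑, IsMorseChart n k A C) ∧ B ⊆ ⋃₀ 𝓑

variable {E : Type} [NormedAddCommGroup E] [NormedSpace ℝ E] {n k : ℕ} {A B : Set E}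

theorem IsMorseChart.isMorseCovered (h : IsMorseChart n k A B) : IsMorseCovered n k A B :=
  ⟨{B}, countable_singleton B, by simpa using h, by simp⟩

theorem IsMorseCovered.mono {C : Set E} (h : IsMorseCovered n k A B) (hCB : C ⊆ B) :
    IsMorseCovered n k A C := by
  obtain ⟨𝓑, h1, h2, h3⟩ := h
  exact ⟨𝓑, h1, h2, hCB.trans h3⟩

theorem IsMorseCovered.biUnion {ι : Type*} {t : Set ι} (ht : t.Countable) {C : ι → Set E}
    (h : ∀ i ∈ t, IsMorseCovered n k A (C i)) : IsMorseCovered n k A (⋃ i ∈ t, C i) := by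
  choose! 𝓑 h1 h2 h3 using h
  refine ⟨⋃ i ∈ t, 𝓑 i, ht.biUnion h1, ?_, ?_⟩
  · intro D hD
    obtain ⟨i, hi, hD⟩ := mem_iUnion₂.1 hD
    exact h2 i hi D hD
  · refine iUnion₂_subset fun i hi => (h3 i hi).trans ?_
    exact sUnion_subset_sUnion (subset_biUnion_of_mem (u := 𝓑) hi)

theorem IsMorseCovered.union {C : Set E} (hB : IsMorseCovered n k A B)
    (hC : IsMorseCovered n k A C) : IsMorseCovered n k A (B ∪ C) := by
  obtain ⟨𝓑, h1, h2, h3⟩ := hB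
  obtain ⟨𝓒, h1', h2', h3'⟩ := hC
  refine ⟨𝓑 ∪ 𝓒, h1.union h1', ?_, ?_⟩
  · rintro D (hD | hD)
    exacts [h2 D hD, h2' D hD]
  · rw [sUnion_union]
    exact union_subset_union h3 h3'

/-- Every set is a Morse chart of order zero. -/
theorem isMorseChart_zero [FiniteDimensional ℝ E] (hn : Module.finrank ℝ E = n) (A : Set E) :
    IsMorseChart n 0 A A := by
  let e : EuclideanSpace ℝ (Fin n) ≃L[ℝ] E := ContinuousLinearEquiv.ofFinrankEq (by simp [hn])
  refine ⟨n, le_rfl, e, e ⁻¹' A, ?_, fun x hx => hx, fun y _ => e.contDiff.contDiffAt, ?_⟩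
  · rw [image_preimage_eq _ e.surjective]
  · intro G _ _ g hg hg0 y hy
    simp only [pow_zero, isLittleO_one_iff]
    have := (hg _ hy).continuousAt.comp e.continuous.continuousAt
    simpa [ContinuousAt, Function.comp_def, hg0 _ hy] using this

/-- A chart of order `k` relative to the set `A' ⊆ A` on which all derivatives of `C^(k+1)`
functions vanishing on `A` vanish is a chart of order `k + 1` relative to `A`. -/
theorem IsMorseChart.succ {A' : Set E} (hA' : A' ⊆ A)
    (hcrit : ∀ (G : Type) [NormedAddCommGroup G] [NormedSpace ℝ G] (g : E → G),
      (∀ x ∈ A, ContDiffAt ℝ (k + 1 : ℕ) g x) → (∀ x ∈ A, g x = 0) → ∀ x ∈ A', fderiv ℝ g x = 0)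
    (h : IsMorseChart n k A' B) : IsMorseChart n (k + 1) A B := by
  obtain ⟨m, hm, ψ, s, hB, hmaps, hψ, hflat⟩ := h
  refine ⟨m, hm, ψ, s, hB, hmaps.mono_right hA', hψ, fun G _ _ g hg hg0 y hy => ?_⟩
  have hgy := hg _ (hA' (hmaps hy))
  have := comp_sub_isLittleO_norm_pow_succ_of_fderiv (k := k) (hψ y hy)
    ((hgy.eventually (by simp)).mono fun z hz => hz.differentiableAt (by simp))
    (hflat _ (fderiv ℝ g) (fun x hx => (hg x (hA' hx)).fderiv_right (by simp))
      (hcrit G g hg hg0) y hy)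
  simpa [hg0 _ (hA' (hmaps hy))] using this

/-- Morse charts are transported by maps that are smooth along the domain. -/
theorem IsMorseChart.image {F : Type} [NormedAddCommGroup F] [NormedSpace ℝ F] {A' B' : Set F}
    {θ : F → E} (hk : k ≠ 0) (hθ : MapsTo θ A' A) (hsm : ∀ z ∈ A', ContDiffAt ℝ k θ z) {m : ℕ}
    (hmn : m ≤ n) (h : IsMorseChart m k A' B') : IsMorseChart n k A (θ '' B') := by
  obtain ⟨l, hl, ψ, s, hB, hmaps, hψ, hflat⟩ := h
  refine ⟨l, hl.trans hmn, θ ∘ ψ, s, ?_, hθ.comp hmaps, fun y hy => ?_, ?_⟩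
  · rw [image_comp]
    exact image_mono hB
  · refine ((hsm _ (hmaps hy)).of_le ?_).comp y (hψ y hy)
    exact_mod_cast Nat.one_le_iff_ne_zero.2 hk
  · intro G _ _ g hg hg0
    exact hflat G (g ∘ θ) (fun z hz => (hg _ (hθ hz)).comp z (hsm z hz))
      fun z hz => hg0 _ (hθ hz)

theorem IsMorseCovered.image {F : Type} [NormedAddCommGroup F] [NormedSpace ℝ F] {A' B' : Set F}
    {θ : F → E} (hk : k ≠ 0) (hθ : MapsTo θ A' A) (hsm : ∀ z ∈ A', ContDiffAt ℝ k θ z) {m : ℕ}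
    (hmn : m ≤ n) (h : IsMorseCovered m k A' B') : IsMorseCovered n k A (θ '' B') := by
  obtain ⟨𝓑, h1, h2, h3⟩ := h
  refine ⟨(θ '' ·) '' 𝓑, h1.image _, ?_, ?_⟩
  · rintro _ ⟨C, hC, rfl⟩
    exact (h2 C hC).image hk hθ hsm hmn
  · rw [← image_sUnion]
    exact image_mono h3

/-- **A. P. Morse's decomposition lemma**: every subset of an `n`-dimensional space is a countable
union of Morse charts of order `k`. -/
theorem isMorseCovered_self (n k : ℕ) (E : Type) [NormedAddCommGroup E] [NormedSpace ℝ E]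
    [FiniteDimensional ℝ E] (hn : Module.finrank ℝ E = n) (A : Set E) :
    IsMorseCovered n k A A := by
  induction n using Nat.strong_induction_on generalizing k E with
  | _ n ihn =>
  induction k generalizing A with
  | zero => exact (isMorseChart_zero hn A).isMorseCovered
  | succ k ihk =>
    let A' : Set E := {x ∈ A | ∀ g : E → ℝ, (∀ z ∈ A, ContDiffAt ℝ (k + 1 : ℕ) g z) →
      (∀ z ∈ A, g z = 0) → fderiv ℝ g x = 0}
    have hA'A : A' ⊆ A := fun x hx => hx.1
    have hcrit : ∀ (G : Type) [NormedAddCommGroup G] [NormedSpace ℝ G] (g : E → G),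
        (∀ x ∈ A, ContDiffAt ℝ (k + 1 : ℕ) g x) → (∀ x ∈ A, g x = 0) →
        ∀ x ∈ A', fderiv ℝ g x = 0 := by
      intro G _ _ g hg hg0 x hx
      ext v
      refine SeparatingDual.eq_zero_of_forall_dual_eq_zero (R := ℝ) fun ℓ => ?_
      have h1 := hx.2 (ℓ ∘ g) (fun z hz => ℓ.contDiff.contDiffAt.comp z (hg z hz))
        fun z hz => by simp [hg0 z hz]
      rw [fderiv_comp x ℓ.differentiableAt ((hg x hx.1).differentiableAt (by simp))] at h1
      simpa using DFunLike.congr_fun h1 v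
    have hcov' : IsMorseCovered n (k + 1) A A' := by
      obtain ⟨𝓑, h1, h2, h3⟩ := ihk A'
      exact ⟨𝓑, h1, fun C hC => (h2 C hC).succ hA'A hcrit, h3⟩
    have hloc : ∀ x ∈ A \ A', ∃ V ∈ 𝓝 x, IsMorseCovered n (k + 1) A (A ∩ V) := by
      rintro x₀ ⟨hx₀, hx₀'⟩
      obtain ⟨g, hg, hg0, hL⟩ : ∃ g : E → ℝ, (∀ z ∈ A, ContDiffAt ℝ (k + 1 : ℕ) g z) ∧
          (∀ z ∈ A, g z = 0) ∧ fderiv ℝ g x₀ ≠ 0 := by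
        by_contra! h
        exact hx₀' ⟨hx₀, h⟩
      obtain ⟨V, hV, Φ, φ, hinv, hsm, hker⟩ :=
        exists_contDiffAt_straightening (Nat.succ_ne_zero k) (hg x₀ hx₀) hL
      refine ⟨V, hV, ?_⟩
      let K : Submodule ℝ E := LinearMap.ker (fderiv ℝ g x₀ : E →ₗ[ℝ] ℝ)
      have hK : Module.finrank ℝ K + 1 = n := by
        rw [← hn]
        exact Module.Dual.finrank_ker_add_one_of_ne_zero
          fun h => hL (ContinuousLinearMap.coe_injective h)
      let A₁ : Set K := {z | (z : E) ∈ Φ '' (A ∩ V)}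
      have hcov := ihn (Module.finrank ℝ K) (by lia) (k + 1) K rfl A₁
      refine (hcov.image (θ := fun z : K => φ z) (A := A) (n := n) (Nat.succ_ne_zero k)
        ?_ ?_ (by lia)).mono ?_
      · rintro z ⟨x, hx, hxz⟩
        simpa only [← hxz, hinv x hx.2] using hx.1
      · rintro z ⟨x, hx, hxz⟩
        have h1 : ContDiffAt ℝ (k + 1 : ℕ) φ (K.subtypeL z) := by
          have := hsm x hx.2
          rwa [hxz] at this
        exact h1.comp z K.subtypeL.contDiff.contDiffAt
      · intro x hx
        exact ⟨⟨Φ x, hker x (hg0 x hx.1)⟩, ⟨x, hx, rfl⟩, hinv x hx.2⟩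
    choose! V hV hVcov using hloc
    obtain ⟨t, ht, htc, htcov⟩ := TopologicalSpace.countable_cover_nhdsWithin
      (s := A \ A') (f := V) fun x hx => mem_nhdsWithin_of_mem_nhds (hV x hx)
    refine (hcov'.union (IsMorseCovered.biUnion htc fun x hx => hVcov x (ht hx))).mono ?_
    intro x hx
    by_cases hx' : x ∈ A'
    · exact Or.inl hx'
    · obtain ⟨i, hi, hxi⟩ := mem_iUnion₂.1 (htcov ⟨hx, hx'⟩)
      exact Or.inr (mem_iUnion₂.2 ⟨i, hi, hx, hxi⟩)

end MorseDecomposition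

section NullImages

open Measure

variable {E : Type*} [NormedAddCommGroup E] [NormedSpace ℝ E] [FiniteDimensional ℝ E]
  [MeasurableSpace E] [BorelSpace E]

/-- If `|h x - h y| ≤ ε ‖x - y‖ ^ d` for points of `s` at distance less than `δ`, where `d ≥ 1` is
the dimension, then the measure of `h '' s` is at most `ε` times that of `s`. -/
theorem volume_image_le_mul_hausdorffMeasure {h : E → ℝ} {s : Set E} {ε : ℝ≥0} {δ : ℝ}
    (hd : 0 < Module.finrank ℝ E) (hδ : 0 < δ)
    (hs : ∀ x ∈ s, ∀ y ∈ s, dist x y < δ → |h x - h y| ≤ ε * ‖x - y‖ ^ Module.finrank ℝ E) :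
    volume (h '' s) ≤ ε * μH[Module.finrank ℝ E] s := by
  let b : ℕ → Set E := fun i => ball (TopologicalSpace.denseSeq E i) (δ / 2)
  let P : ℕ → Set E := disjointed b
  have hPm : ∀ i, MeasurableSet (P i) := MeasurableSet.disjointed fun i => measurableSet_ball
  have hPU : ⋃ i, P i = univ := by
    rw [iUnion_disjointed]
    refine eq_univ_of_forall fun x => ?_
    obtain ⟨i, hi⟩ := (TopologicalSpace.denseRange_denseSeq E).exists_dist_lt x (half_pos hδ)
    exact mem_iUnion.2 ⟨i, hi⟩
  have hpiece : ∀ i, volume (h '' (P i ∩ s)) ≤ ε * μH[Module.finrank ℝ E] (P i ∩ s) := by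
    intro i
    have hH : HolderOnWith ε (Module.finrank ℝ E : ℝ≥0) h (P i ∩ s) := by
      rintro x ⟨hxP, hx⟩ y ⟨hyP, hy⟩
      have hxb := mem_ball.1 (disjointed_subset b i hxP)
      have hyb := mem_ball.1 (disjointed_subset b i hyP)
      have hxy := hs x hx y hy
        (by linarith [dist_triangle_right x y (TopologicalSpace.denseSeq E i)])
      rw [edist_dist, edist_dist, Real.dist_eq, dist_eq_norm, NNReal.coe_natCast,
        ENNReal.rpow_natCast, ← ENNReal.ofReal_pow (norm_nonneg _), ← ENNReal.ofReal_coe_nnreal,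
        ← ENNReal.ofReal_mul ε.coe_nonneg]
      exact ENNReal.ofReal_le_ofReal hxy
    simpa [hausdorffMeasure_real] using
      hH.hausdorffMeasure_image_le (by exact_mod_cast hd) zero_le_one
  calc volume (h '' s) = volume (⋃ i, h '' (P i ∩ s)) := by
        rw [← image_iUnion, ← iUnion_inter, hPU, univ_inter]
    _ ≤ ∑' i, volume (h '' (P i ∩ s)) := measure_iUnion_le _
    _ ≤ ∑' i, ε * μH[Module.finrank ℝ E] (P i ∩ s) := ENNReal.tsum_le_tsum hpiece
    _ = ε * ∑' i, (μH[Module.finrank ℝ E]).restrict s (P i) := by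
        rw [ENNReal.tsum_mul_left]
        simp_rw [restrict_apply (hPm _)]
    _ = ε * μH[Module.finrank ℝ E] s := by
        rw [← measure_iUnion (disjoint_disjointed b) hPm, hPU, restrict_apply_univ]

/-- A real function on a `d`-dimensional space with `h x - h y = o(‖x - y‖ ^ d)` at every `y ∈ s`
maps `s` to a null set. -/
theorem volume_image_eq_zero_of_isLittleO {h : E → ℝ} {s : Set E}
    (hs : ∀ y ∈ s, (fun x => h x - h y) =o[𝓝 y] fun x => ‖x - y‖ ^ Module.finrank ℝ E) :
    volume (h '' s) = 0 := by
  rcases Nat.eq_zero_or_pos (Module.finrank ℝ E) with hd | hd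
  · have := Module.finrank_zero_iff.1 hd
    exact (s.subsingleton_of_subsingleton.image h).measure_zero volume
  have hbdd : ∀ R : ℕ, volume (h '' (s ∩ ball 0 R)) = 0 := by
    intro R
    have hfin : μH[Module.finrank ℝ E] (ball (0 : E) R) ≠ ∞ := measure_ball_lt_top.ne
    have hε : ∀ ε : ℝ≥0, 0 < ε →
        volume (h '' (s ∩ ball 0 R)) ≤ ε * μH[Module.finrank ℝ E] (ball (0 : E) R) := by
      intro ε hε
      let T : ℕ → Set E := fun j => {y ∈ s ∩ ball 0 R | ∀ x, dist x y < 1 / ((j : ℝ) + 1) →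
        |h x - h y| ≤ ε * ‖x - y‖ ^ Module.finrank ℝ E}
      have hTmono : Monotone T := fun i j hij y hy =>
        ⟨hy.1, fun x hx => hy.2 x (hx.trans_le (Nat.one_div_le_one_div hij))⟩
      have hTU : s ∩ ball 0 R = ⋃ j, T j := by
        refine Subset.antisymm (fun y hy => ?_) (iUnion_subset fun j y hy => hy.1)
        obtain ⟨δ, hδ, hball⟩ :=
          Metric.eventually_nhds_iff.1 (isLittleO_iff.1 (hs y hy.1) (NNReal.coe_pos.2 hε))
        obtain ⟨j, hj⟩ := exists_nat_one_div_lt hδ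
        refine mem_iUnion.2 ⟨j, hy, fun x hx => ?_⟩
        simpa using hball (hx.trans hj)
      rw [hTU, image_iUnion, Monotone.measure_iUnion fun i j hij => image_mono (hTmono hij)]
      refine iSup_le fun j => ?_
      refine (volume_image_le_mul_hausdorffMeasure hd (Nat.one_div_pos_of_nat (n := j))
        fun x _ y hy hxy => hy.2 x hxy).trans ?_
      gcongr
      exact fun y hy => hy.1.2
    have hlim : Tendsto (fun ε : ℝ≥0 => (ε : ℝ≥0∞) * μH[Module.finrank ℝ E] (ball (0 : E) R))
        (𝓝[>] 0) (𝓝 0) := by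
      have : Tendsto (fun ε : ℝ≥0 => (ε : ℝ≥0∞) * μH[Module.finrank ℝ E] (ball (0 : E) R))
          (𝓝 0) (𝓝 (((0 : ℝ≥0) : ℝ≥0∞) * μH[Module.finrank ℝ E] (ball (0 : E) R))) :=
        ENNReal.Tendsto.mul_const (ENNReal.tendsto_coe.2 tendsto_id) (Or.inr hfin)
      simpa using this.mono_left nhdsWithin_le_nhds
    refine le_antisymm (ge_of_tendsto hlim ?_) zero_le
    filter_upwards [self_mem_nhdsWithin] with ε h0 using hε ε h0
  have hU : s = ⋃ R : ℕ, s ∩ ball 0 R := by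
    rw [← inter_iUnion, iUnion_ball_nat, inter_univ]
  rw [hU, image_iUnion]
  exact measure_iUnion_null hbdd

end NullImages

/-- **Morse–Sard theorem** for real functions: the critical values of a `C^n` function on an
`n`-dimensional space form a null set. -/
theorem volume_image_setOf_fderiv_eq_zero {E : Type} [NormedAddCommGroup E] [NormedSpace ℝ E]
    [FiniteDimensional ℝ E] {n : ℕ} (hE : Module.finrank ℝ E = n) (hn : 1 ≤ n) {f : E → ℝ}
    (hf : ContDiff ℝ n f) : volume (f '' {x | fderiv ℝ f x = 0}) = 0 := by
  obtain ⟨k, rfl⟩ := Nat.exists_eq_add_of_le' hn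
  obtain ⟨𝓑, hc, hchart, hcov⟩ := isMorseCovered_self (k + 1) k E hE {x | fderiv ℝ f x = 0}
  refine measure_mono_null (image_mono hcov) ?_
  rw [image_sUnion]
  refine (measure_sUnion_null_iff (hc.image _)).2 ?_
  rintro _ ⟨B, hB, rfl⟩
  obtain ⟨m, hm, ψ, s, hBs, -, hψ, hflat⟩ := hchart B hB
  refine measure_mono_null (image_mono hBs) ?_
  rw [← image_comp]
  refine volume_image_eq_zero_of_isLittleO fun y hy => ?_
  rw [finrank_euclideanSpace_fin]
  have hfd : ContDiff ℝ k (fderiv ℝ f) := hf.fderiv_right (by simp)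
  refine (comp_sub_isLittleO_norm_pow_succ_of_fderiv (k := k) (hψ y hy)
    (Eventually.of_forall fun z => hf.differentiable (by simp) z)
    (hflat _ (fderiv ℝ f) (fun x _ => hfd.contDiffAt) (fun x hx => hx) y hy)).trans_isBigO ?_
  refine IsBigO.of_bound 1 ?_
  filter_upwards [ball_mem_nhds y one_pos] with x hx
  rw [mem_ball_iff_norm] at hx
  simpa using pow_le_pow_of_le_one (norm_nonneg _) hx.le hm


/-- Let `n ≥ 1` and let `f : ℝⁿ → ℝ` be `n` times continuously
differentiable. Then `f` is constant on every connected subset of its critical set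
`Crit(f) = {x | ∇f(x) = 0}`: if `S ⊆ Crit(f)` is connected then `f a = f b` for all
`a, b ∈ S`. (Consequence of the Morse–Sard theorem.) -/
theorem statement6 (n : ℕ) (hn : 1 ≤ n) (f : EuclideanSpace ℝ (Fin n) → ℝ)
    (hf : ContDiff ℝ n f) (S : Set (EuclideanSpace ℝ (Fin n)))
    (hS : S ⊆ {x | fderiv ℝ f x = 0}) (hconn : IsConnected S) :
    ∀ a ∈ S, ∀ b ∈ S, f a = f b := by
  have hnull : volume (f '' S) = 0 := measure_mono_null (image_mono hS)
    (volume_image_setOf_fderiv_eq_zero finrank_euclideanSpace_fin hn hf)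
  have hconn' : (f '' S).OrdConnected :=
    (hconn.isPreconnected.image f hf.continuous.continuousOn).ordConnected
  have hle : ∀ a ∈ S, ∀ b ∈ S, f b ≤ f a := by
    intro a ha b hb
    have hIcc : volume (Icc (f a) (f b)) = 0 :=
      measure_mono_null (hconn'.out (mem_image_of_mem f ha) (mem_image_of_mem f hb)) hnull
    simpa using hIcc
  exact fun a ha b hb => le_antisymm (hle b hb a ha) (hle a ha b hb)
end

section
/- Let G be a finite arborescence of depth L ≥ 1 with edge set E, leaf edges 𝓛(G), and root-to-leaf paths Γ(G), with strictly positive coefficients ν : Γ(G) → (0,∞) and targets z : Γ(G) → ℝ. For ε > 0 and real constants (C_f)_{f ∈ E∖𝓛(G)} with |C_f| < ∞, the set B(ε, {C_f}) = { W ∈ ℝ^E : ℐ(W) ≤ ε and W_f² − ∑_{l∈𝓛(G;f)} W_l² = C_f for every f ∈ E∖𝓛(G) } is a compact subset of ℝ^E, where ℐ(W) = ∑_{γ∈Γ(G)} ν_γ (z_γ − P_γ(W))² and P_γ(W) = ∏_{e∈γ} W_e. -/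
/-- If every other factor dominates a distinguished factor up to `K`, a bound on the square of the
product bounds the square of the distinguished factor. -/
theorem sq_le_of_prod_sq_le {E : Type*} [DecidableEq E] {s : Finset E} {a : E} (ha : a ∈ s)
    {W : E → ℝ} {K M : ℝ} (hK : 0 ≤ K) (hdom : ∀ e ∈ s, e ≠ a → W a ^ 2 - K ≤ W e ^ 2)
    (hprod : (∏ e ∈ s, W e) ^ 2 ≤ M) : W a ^ 2 ≤ K + 1 + M := by
  have hM : 0 ≤ M := (sq_nonneg _).trans hprod
  by_contra! h
  have hge : 1 ≤ ∏ e ∈ s.erase a, W e ^ 2 := by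
    refine Finset.prod_induction _ (fun x : ℝ => 1 ≤ x) (fun _ _ => one_le_mul_of_one_le_of_one_le)
      le_rfl fun e he => ?_
    have := hdom e (Finset.mem_of_mem_erase he) (Finset.ne_of_mem_erase he)
    linarith
  rw [← Finset.prod_pow, ← Finset.mul_prod_erase s _ ha] at hprod
  have := le_mul_of_one_le_right (sq_nonneg (W a)) hge
  linarith

/-- `G` is a finite arborescence of depth `L ≥ 1`: its root-to-leaf paths
are indexed by the leaves `ι`; `path l` is the edge set (of cardinality `L`) of the path to
leaf `l`; `leafE l ∈ path l` is its leaf edge; distinct leaves have distinct leaf edges, a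
leaf edge lies only on its own path, and every edge lies on some path.  The leaf edges below
an edge `f` are `{leafE l : f ∈ path l}`.  For strictly positive coefficients `ν`, targets
`z`, `ε > 0` and finite constants `C_f`, the set
`B(ε, {C_f}) = {W : ℐ(W) ≤ ε ∧ W_f² − ∑_{l∈𝓛(G;f)} W_l² = C_f ∀ f ∈ E∖𝓛(G)}`
is compact, where `ℐ(W) = ∑_γ ν_γ (z_γ − P_γ(W))²`, `P_γ(W) = ∏_{e∈γ} W_e`. -/
theorem statement11 {E ι : Type*} [Fintype E] [DecidableEq E] [Fintype ι] [DecidableEq ι]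
    (L : ℕ) (hL : 1 ≤ L) (path : ι → Finset E) (leafE : ι → E)
    (hcard : ∀ l, (path l).card = L)
    (hmem : ∀ l, leafE l ∈ path l)
    (hinj : Function.Injective leafE)
    (huniq : ∀ l l', leafE l ∈ path l' → l' = l)
    (hcover : ∀ e, ∃ l, e ∈ path l)
    (ν : ι → ℝ) (hν : ∀ l, 0 < ν l) (z : ι → ℝ)
    (ε : ℝ) (hε : 0 < ε) (C : E → ℝ) :
    IsCompact {W : E → ℝ |
      (∑ l, ν l * (z l - ∏ e ∈ path l, W e) ^ 2) ≤ ε ∧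
      ∀ f, f ∉ Finset.univ.image leafE →
        W f ^ 2 - (∑ l ∈ Finset.univ.filter fun l => f ∈ path l, W (leafE l) ^ 2) = C f} := by
  set K : ℝ := ∑ f, |C f|
  have hK : 0 ≤ K := Finset.sum_nonneg fun f _ => abs_nonneg _
  have hCK (f : E) : |C f| ≤ K :=
    Finset.single_le_sum (f := fun f => |C f|) (fun f _ => abs_nonneg _) (Finset.mem_univ f)
  set A : ι → ℝ := fun l => K + 1 + (2 * z l ^ 2 + 2 * (ε / ν l))
  have hA0 (l : ι) : 0 ≤ A l := by
    have := hν l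
    positivity
  set T : ℝ := K + ∑ l, A l
  have hAT (l : ι) : A l ≤ T := by
    have := Finset.single_le_sum (f := A) (fun l _ => hA0 l) (Finset.mem_univ l)
    linarith
  refine (isCompact_univ_pi fun _ : E =>
    isCompact_Icc (a := -(T + 1)) (b := T + 1)).of_isClosed_subset
    ?_ ?_
  · simp only [Set.ofPred_and, Set.ofPred_forall]
    refine (isClosed_le (by fun_prop) continuous_const).inter ?_
    exact isClosed_iInter fun f => isClosed_iInter fun _ => isClosed_eq (by fun_prop) continuous_const
  · rintro W ⟨hI, hC⟩
    have hleaf (l : ι) : W (leafE l) ^ 2 ≤ A l := by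
      refine sq_le_of_prod_sq_le (hmem l) hK (fun f hf hne => ?_) ?_
      · have hnl : f ∉ Finset.univ.image leafE := by
          simp only [Finset.mem_image, Finset.mem_univ, true_and, not_exists]
          rintro l' rfl
          exact hne (congrArg leafE (huniq l' l hf).symm)
        have hle := Finset.single_le_sum (f := fun l => W (leafE l) ^ 2)
          (s := Finset.univ.filter fun l => f ∈ path l) (fun l _ => sq_nonneg _)
          (Finset.mem_filter.2 ⟨Finset.mem_univ l, hf⟩)
        have := hC f hnl
        have := neg_abs_le (C f)
        have := hCK f
        linarith
      · have hle := (Finset.single_le_sum (f := fun l => ν l * (z l - ∏ e ∈ path l, W e) ^ 2)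
          (fun l _ => mul_nonneg (hν l).le (sq_nonneg _)) (Finset.mem_univ l)).trans hI
        have hle' : (z l - ∏ e ∈ path l, W e) ^ 2 ≤ ε / ν l := by
          rw [le_div_iff₀ (hν l), mul_comm]
          exact hle
        nlinarith [sq_nonneg (2 * z l - ∏ e ∈ path l, W e)]
    have hsq (f : E) : W f ^ 2 ≤ T := by
      by_cases hf : f ∈ Finset.univ.image leafE
      · obtain ⟨l, -, rfl⟩ := Finset.mem_image.1 hf
        exact (hleaf l).trans (hAT l)
      · have hsum : ∑ l ∈ Finset.univ.filter (fun l => f ∈ path l), W (leafE l) ^ 2 ≤ ∑ l, A l :=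
          (Finset.sum_le_sum fun l _ => hleaf l).trans
            (Finset.sum_le_sum_of_subset_of_nonneg (Finset.filter_subset _ _) fun l _ _ => hA0 l)
        have := hC f hf
        have := le_abs_self (C f)
        have := hCK f
        linarith
    intro f _
    have hT0 : 0 ≤ T := (sq_nonneg _).trans (hsq f)
    exact abs_le.1 (abs_le_of_sq_le_sq (by nlinarith [hsq f]) (by linarith))
end

section
/- Let G be a finite arborescence of depth L ≥ 1 with edge set E, leaf edges 𝓛(G), and root-to-leaf paths Γ(G), with coefficients ν : Γ(G) → (0,∞) and targets z : Γ(G) → ℝ. Then for every W ∈ ℝ^E, the Polyak–Łojasiewicz inequality ‖∇ℐ(W)‖₂² ≥ 4·ν_min·( min_{f ∈ E∖𝓛(G)} W_f² )^{L−1}·ℐ(W) holds, where ℐ(W) = ∑_{γ∈Γ(G)} ν_γ(z_γ − P_γ(W))² and ν_min = min_γ ν_γ. In particular, if C_min(W) := min_{f∈E∖𝓛(G)} (W_f² − ∑_{l∈𝓛(G;f)} W_l²) ≥ 0, then ‖∇ℐ(W)‖₂² ≥ 4 ν_min C_min(W)^{L−1} ℐ(W). -/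
/-- The coordinates of the gradient on Euclidean space are the partial derivatives. -/
theorem gradient_apply_eq_fderiv_single {E : Type*} [Fintype E] [DecidableEq E]
    (f : EuclideanSpace ℝ E → ℝ) (W : EuclideanSpace ℝ E) (e : E) :
    gradient f W e = fderiv ℝ f W (EuclideanSpace.single e 1) := by
  have h : inner ℝ (gradient f W) (EuclideanSpace.single e (1 : ℝ))
      = fderiv ℝ f W (EuclideanSpace.single e 1) := by
    rw [gradient, InnerProductSpace.toDual_symm_apply]
  rw [← h, EuclideanSpace.inner_single_right]
  simp

/-- Partial derivative of the weighted square loss in the direction of an edge `leafE k`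
that lies on the path `path k` only. -/
theorem gradient_square_loss_apply_leaf {E ι : Type*} [Fintype E] [DecidableEq E] [Fintype ι]
    (path : ι → Finset E) (leafE : ι → E)
    (hmem : ∀ l, leafE l ∈ path l) (huniq : ∀ l l', leafE l ∈ path l' → l' = l)
    (ν z : ι → ℝ) (W : EuclideanSpace ℝ E) (k : ι) :
    gradient (fun V : EuclideanSpace ℝ E => ∑ l, ν l * (z l - ∏ e ∈ path l, V e) ^ 2) W (leafE k)
      = -(2 * ν k * (z k - ∏ e ∈ path k, W e) * ∏ e ∈ (path k).erase (leafE k), W e) := by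
  have hcoord (e : E) : HasFDerivAt (fun V : EuclideanSpace ℝ E => V e)
      (EuclideanSpace.proj e : EuclideanSpace ℝ E →L[ℝ] ℝ) W :=
    (EuclideanSpace.proj e : EuclideanSpace ℝ E →L[ℝ] ℝ).hasFDerivAt
  have hloss := HasFDerivAt.fun_sum (u := Finset.univ) fun l _ =>
    (((HasFDerivAt.finsetProd (u := path l) fun e _ => hcoord e).const_sub (z l)).pow 2).const_mul
      (ν l)
  rw [gradient_apply_eq_fderiv_single, hloss.fderiv]
  simp only [sum_apply, smul_apply,
    neg_apply, PiLp.proj_apply, PiLp.single_apply,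
    smul_eq_mul]
  rw [Finset.sum_eq_single k]
  · rw [Finset.sum_eq_single (leafE k)]
    · simp
      ring
    · intro e _ he
      simp [he]
    · exact fun h => absurd (hmem k) h
  · intro l _ hl
    rw [Finset.sum_eq_zero]
    · simp
    · intro e he
      rw [if_neg, mul_zero]
      rintro rfl
      exact hl (huniq k l he)
  · simp

/-- A Polyak–Łojasiewicz inequality for the weighted square loss, with any nonnegative lower
bound `m` for the squares of the non-leaf weights. -/
theorem square_loss_le_norm_gradient_sq {E ι : Type*} [Fintype E] [DecidableEq E] [Fintype ι]
    [DecidableEq ι] (L : ℕ) (path : ι → Finset E) (leafE : ι → E)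
    (hcard : ∀ l, (path l).card = L)
    (hmem : ∀ l, leafE l ∈ path l) (hinj : Function.Injective leafE)
    (huniq : ∀ l l', leafE l ∈ path l' → l' = l)
    (ν : ι → ℝ) (hν : ∀ l, 0 < ν l) (z : ι → ℝ) (W : EuclideanSpace ℝ E)
    (c m : ℝ) (hc : ∀ l, c ≤ ν l) (hm : 0 ≤ m)
    (hmW : ∀ f ∈ Finset.univ \ Finset.univ.image leafE, m ≤ W f ^ 2) :
    4 * c * m ^ (L - 1) * (∑ l, ν l * (z l - ∏ e ∈ path l, W e) ^ 2) ≤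
      ‖gradient (fun V : EuclideanSpace ℝ E =>
        ∑ l, ν l * (z l - ∏ e ∈ path l, V e) ^ 2) W‖ ^ 2 := by
  have hprod (l : ι) : m ^ (L - 1) ≤ (∏ e ∈ (path l).erase (leafE l), W e) ^ 2 := by
    rw [← hcard l, ← Finset.card_erase_of_mem (hmem l), ← Finset.prod_pow, ← Finset.prod_const]
    refine Finset.prod_le_prod (fun _ _ => hm) fun e he => hmW e ?_
    simp only [Finset.mem_sdiff, Finset.mem_univ, true_and, Finset.mem_image, not_exists]
    rintro k rfl
    obtain ⟨hne, hk⟩ := Finset.mem_erase.1 he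
    exact hne (congrArg leafE (huniq k l hk).symm)
  rw [EuclideanSpace.real_norm_sq_eq]
  refine le_trans ?_ (Finset.sum_le_univ_sum_of_nonneg
    (s := Finset.univ.image leafE) fun e => sq_nonneg _)
  rw [Finset.sum_image hinj.injOn, Finset.mul_sum]
  refine Finset.sum_le_sum fun l _ => ?_
  rw [gradient_square_loss_apply_leaf path leafE hmem huniq]
  have hcm : c * m ^ (L - 1) ≤ ν l * (∏ e ∈ (path l).erase (leafE l), W e) ^ 2 :=
    mul_le_mul (hc l) (hprod l) (pow_nonneg hm _) (hν l).le
  have hl : 0 ≤ 4 * ν l * (z l - ∏ e ∈ path l, W e) ^ 2 := by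
    have := hν l
    positivity
  linarith [mul_le_mul_of_nonneg_left hcm hl]


/-- Polyak–Łojasiewicz inequality for `ℐ` on an arborescence of depth
`L ≥ 1` (leaf-indexed paths as in the arborescence encoding): for every `W`,
`‖∇ℐ(W)‖₂² ≥ 4 ν_min (min_{f∈E∖𝓛(G)} W_f²)^{L−1} ℐ(W)`, and in particular, if
`C_min(W) = min_{f∈E∖𝓛(G)} (W_f² − ∑_{l∈𝓛(G;f)} W_l²) ≥ 0`, then
`‖∇ℐ(W)‖₂² ≥ 4 ν_min C_min(W)^{L−1} ℐ(W)`. -/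
theorem statement13 {E ι : Type*} [Fintype E] [DecidableEq E] [Fintype ι] [DecidableEq ι]
    [Nonempty ι]
    (L : ℕ) (hL : 1 ≤ L) (path : ι → Finset E) (leafE : ι → E)
    (hcard : ∀ l, (path l).card = L)
    (hmem : ∀ l, leafE l ∈ path l)
    (hinj : Function.Injective leafE)
    (huniq : ∀ l l', leafE l ∈ path l' → l' = l)
    (hcover : ∀ e, ∃ l, e ∈ path l)
    (hne : (Finset.univ \ Finset.univ.image leafE).Nonempty)
    (ν : ι → ℝ) (hν : ∀ l, 0 < ν l) (z : ι → ℝ) :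
    ∀ W : EuclideanSpace ℝ E,
      (‖gradient (fun V : EuclideanSpace ℝ E => ∑ l, ν l * (z l - ∏ e ∈ path l, V e) ^ 2) W‖ ^ 2
          ≥ 4 * (Finset.univ.inf' Finset.univ_nonempty ν) *
              ((Finset.univ \ Finset.univ.image leafE).inf' hne fun f => W f ^ 2) ^ (L - 1) *
              (∑ l, ν l * (z l - ∏ e ∈ path l, W e) ^ 2)) ∧
        (0 ≤ (Finset.univ \ Finset.univ.image leafE).inf' hne
              (fun f => W f ^ 2 - ∑ l ∈ Finset.univ.filter fun l => f ∈ path l, W (leafE l) ^ 2) →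
          ‖gradient (fun V : EuclideanSpace ℝ E => ∑ l, ν l * (z l - ∏ e ∈ path l, V e) ^ 2) W‖ ^ 2
            ≥ 4 * (Finset.univ.inf' Finset.univ_nonempty ν) *
                ((Finset.univ \ Finset.univ.image leafE).inf' hne
                  fun f => W f ^ 2 - ∑ l ∈ Finset.univ.filter fun l => f ∈ path l, W (leafE l) ^ 2) ^ (L - 1) *
                (∑ l, ν l * (z l - ∏ e ∈ path l, W e) ^ 2)) := by
  intro W
  have hc (l : ι) : Finset.univ.inf' Finset.univ_nonempty ν ≤ ν l :=
    Finset.inf'_le _ (Finset.mem_univ l)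
  refine ⟨?_, fun hC => ?_⟩
  · exact square_loss_le_norm_gradient_sq L path leafE hcard hmem hinj huniq ν hν z W _ _ hc
      (Finset.le_inf' _ _ fun _ _ => sq_nonneg _) fun f hf => Finset.inf'_le _ hf
  · exact square_loss_le_norm_gradient_sq L path leafE hcard hmem hinj huniq ν hν z W _ _ hc hC
      fun f hf => (Finset.inf'_le _ hf).trans
        (sub_le_self _ (Finset.sum_nonneg fun _ _ => sq_nonneg _))
end

section
/- Let G be a finite arborescence of depth L ≥ 1 with edge set E, leaf edges 𝓛(G), and root-to-leaf paths Γ(G), with coefficients ν : Γ(G) → (0,∞) and targets z : Γ(G) → ℝ. For any W ∈ ℝ^E, any step size α, and any non-leaf edge f ∈ E∖𝓛(G), one gradient-descent step W⁺ := W − α∇ℐ(W) changes the conserved quantity C_f(W) = W_f² − ∑_{l∈𝓛(G;f)} W_l² only at second order in α: C_f(W⁺) = C_f(W) + α²·( (∂ℐ/∂W_f(W))² − ∑_{l∈𝓛(G;f)} (∂ℐ/∂W_l(W))² ); the first-order terms cancel because W_f ∂ℐ/∂W_f = ∑_{l∈𝓛(G;f)} W_l ∂ℐ/∂W_l. -/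
theorem mul_fderiv_prod_apply_single {E : Type*} [Fintype E] [DecidableEq E]
    (s : Finset E) (W : E → ℝ) (e : E) :
    W e * fderiv ℝ (fun V : E → ℝ => ∏ i ∈ s, V i) W (Pi.single e 1)
      = if e ∈ s then ∏ i ∈ s, W i else 0 := by
  have h : HasFDerivAt (fun V : E → ℝ => ∏ i ∈ s, V i)
      (∑ i ∈ s, (∏ j ∈ s.erase i, W j) • ContinuousLinearMap.proj (R := ℝ) i) W :=
    HasFDerivAt.finsetProd fun i _ => hasFDerivAt_apply i W
  rw [h.fderiv]
  simp only [sum_apply, smul_apply,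
    ContinuousLinearMap.proj_apply, Pi.single_apply, smul_eq_mul, mul_ite, mul_one, mul_zero,
    Finset.sum_ite_eq']
  split_ifs with he
  · exact Finset.mul_prod_erase s W he
  · rfl

theorem mul_fderiv_loss_apply_single {E ι : Type*} [Fintype E] [DecidableEq E] [Fintype ι]
    (path : ι → Finset E) (ν z : ι → ℝ) (W : E → ℝ) (e : E) :
    W e * fderiv ℝ (fun V : E → ℝ => ∑ l, ν l * (z l - ∏ i ∈ path l, V i) ^ 2) W
        (Pi.single e 1)
      = ∑ l ∈ Finset.univ.filter fun l => e ∈ path l,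
          -2 * ν l * (z l - ∏ i ∈ path l, W i) * ∏ i ∈ path l, W i := by
  have hP (l : ι) : HasFDerivAt (fun V : E → ℝ => ∏ i ∈ path l, V i)
      (fderiv ℝ (fun V : E → ℝ => ∏ i ∈ path l, V i) W) W :=
    (HasFDerivAt.finsetProd fun i _ => hasFDerivAt_apply i W).differentiableAt.hasFDerivAt
  have h := HasFDerivAt.fun_sum (u := Finset.univ) fun l (_ : l ∈ Finset.univ) =>
    (((hP l).const_sub (z l)).pow 2).const_mul (ν l)
  rw [HasFDerivAt.fderiv h, sum_apply, Finset.mul_sum, Finset.sum_filter]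
  refine Finset.sum_congr rfl fun l _ => ?_
  have hl := mul_fderiv_prod_apply_single (path l) W e
  simp only [smul_apply, neg_apply, smul_eq_mul,
    nsmul_eq_mul]
  rw [← mul_ite_zero, ← hl]
  ring

theorem sq_sub_sum_sq_sub_mul {ι : Type*} (s : Finset ι) (α a b : ℝ) (w d : ι → ℝ)
    (h : a * b = ∑ i ∈ s, w i * d i) :
    (a - α * b) ^ 2 - ∑ i ∈ s, (w i - α * d i) ^ 2
      = (a ^ 2 - ∑ i ∈ s, w i ^ 2) + α ^ 2 * (b ^ 2 - ∑ i ∈ s, d i ^ 2) := by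
  have hs : ∑ i ∈ s, (w i - α * d i) ^ 2
      = ∑ i ∈ s, w i ^ 2 - 2 * α * ∑ i ∈ s, w i * d i + α ^ 2 * ∑ i ∈ s, d i ^ 2 := by
    simp only [Finset.mul_sum, ← Finset.sum_sub_distrib, ← Finset.sum_add_distrib]
    exact Finset.sum_congr rfl fun i _ => by ring
  rw [hs, ← h]
  ring

/-- On an arborescence of depth `L ≥ 1` (leaf-indexed paths), one
gradient-descent step `W⁺ = W − α ∇ℐ(W)` on `ℐ(W) = ∑_γ ν_γ (z_γ − P_γ(W))²` changes each
conserved quantity `C_f(W) = W_f² − ∑_{l∈𝓛(G;f)} W_l²` (for `f` a non-leaf edge) only at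
second order in `α`:
`C_f(W⁺) = C_f(W) + α² ((∂ℐ/∂W_f)² − ∑_{l∈𝓛(G;f)} (∂ℐ/∂W_l)²)`, because the first-order
terms cancel: `W_f ∂ℐ/∂W_f = ∑_{l∈𝓛(G;f)} W_l ∂ℐ/∂W_l`. -/
theorem statement14 {E ι : Type*} [Fintype E] [DecidableEq E] [Fintype ι] [DecidableEq ι]
    (L : ℕ) (hL : 1 ≤ L) (path : ι → Finset E) (leafE : ι → E)
    (hcard : ∀ l, (path l).card = L)
    (hmem : ∀ l, leafE l ∈ path l)
    (hinj : Function.Injective leafE)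
    (huniq : ∀ l l', leafE l ∈ path l' → l' = l)
    (hcover : ∀ e, ∃ l, e ∈ path l)
    (ν : ι → ℝ) (hν : ∀ l, 0 < ν l) (z : ι → ℝ)
    (W : E → ℝ) (α : ℝ) (f : E) (hf : f ∉ Finset.univ.image leafE) :
    ((fun e => W e - α * fderiv ℝ
          (fun V : E → ℝ => ∑ l, ν l * (z l - ∏ e' ∈ path l, V e') ^ 2) W (Pi.single e 1)) f ^ 2
        - ∑ l ∈ Finset.univ.filter fun l => f ∈ path l,
            (fun e => W e - α * fderiv ℝ
              (fun V : E → ℝ => ∑ l', ν l' * (z l' - ∏ e' ∈ path l', V e') ^ 2) W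
              (Pi.single e 1)) (leafE l) ^ 2)
      = (W f ^ 2 - ∑ l ∈ Finset.univ.filter fun l => f ∈ path l, W (leafE l) ^ 2)
        + α ^ 2 *
          ((fderiv ℝ (fun V : E → ℝ => ∑ l, ν l * (z l - ∏ e' ∈ path l, V e') ^ 2) W
              (Pi.single f 1)) ^ 2
            - ∑ l ∈ Finset.univ.filter fun l => f ∈ path l,
                (fderiv ℝ (fun V : E → ℝ => ∑ l', ν l' * (z l' - ∏ e' ∈ path l', V e') ^ 2) W
                  (Pi.single (leafE l) 1)) ^ 2) ∧
    W f * fderiv ℝ (fun V : E → ℝ => ∑ l, ν l * (z l - ∏ e' ∈ path l, V e') ^ 2) W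
        (Pi.single f 1)
      = ∑ l ∈ Finset.univ.filter fun l => f ∈ path l,
          W (leafE l) *
            fderiv ℝ (fun V : E → ℝ => ∑ l', ν l' * (z l' - ∏ e' ∈ path l', V e') ^ 2) W
              (Pi.single (leafE l) 1) := by
  have balance : W f * fderiv ℝ (fun V : E → ℝ => ∑ l, ν l * (z l - ∏ e' ∈ path l, V e') ^ 2) W
        (Pi.single f 1)
      = ∑ l ∈ Finset.univ.filter fun l => f ∈ path l,
          W (leafE l) *
            fderiv ℝ (fun V : E → ℝ => ∑ l', ν l' * (z l' - ∏ e' ∈ path l', V e') ^ 2) W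
              (Pi.single (leafE l) 1) := by
    rw [mul_fderiv_loss_apply_single]
    refine Finset.sum_congr rfl fun l _ => ?_
    have hl : (Finset.univ.filter fun l' => leafE l ∈ path l') = {l} := by
      ext l'
      simp only [Finset.mem_filter, Finset.mem_univ, true_and, Finset.mem_singleton]
      exact ⟨huniq l l', fun h => h ▸ hmem l⟩
    rw [mul_fderiv_loss_apply_single, hl, Finset.sum_singleton]
  exact ⟨sq_sub_sum_sq_sub_mul _ α _ _ _ _ balance, balance⟩
end

section
/- Let G be a finite arborescence of depth L ≥ 1 with edge set E, leaf edges 𝓛(G), and root-to-leaf paths Γ(G), with coefficients ν : Γ(G) → (0,∞) and targets z : Γ(G) → ℝ. Let W ∈ ℝ^E satisfy C_f(W) > 0 for every f ∈ E∖𝓛(G), where C_f(W) = W_f² − ∑_{l∈𝓛(G;f)} W_l². Then for any step size α > 0 and W⁺ := W − α∇ℐ(W), every non-leaf edge f satisfies |C_f(W⁺) − C_f(W)| ≤ 4·α²·‖ν‖₁·( max_{e∈E∖𝓛(G)} W_e² )^{L−1}·ℐ(W). In particular, if additionally |W_e| ≤ M for all e ∈ E∖𝓛(G), then |C_f(W⁺)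 − C_f(W)| ≤ 4 α² ‖ν‖₁ M^{2(L−1)} ℐ(W). -/
/-- Partial derivative of the weighted least-squares loss of monomials `∏ e ∈ path l, V e`. -/
theorem fderiv_pathLoss_single {E ι : Type*} [Fintype E] [DecidableEq E] [Fintype ι]
    (path : ι → Finset E) (ν z : ι → ℝ) (W : E → ℝ) (e : E) :
    fderiv ℝ (fun V : E → ℝ => ∑ l, ν l * (z l - ∏ e' ∈ path l, V e') ^ 2) W (Pi.single e 1)
      = -2 * ∑ l ∈ Finset.univ.filter fun l => e ∈ path l,
          ν l * (z l - ∏ e' ∈ path l, W e') * ∏ e' ∈ (path l).erase e, W e' := by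
  have hprod : ∀ l, HasFDerivAt (fun V : E → ℝ => ∏ e' ∈ path l, V e')
      (∑ i ∈ path l, (∏ j ∈ (path l).erase i, W j) •
        (ContinuousLinearMap.proj i : (E → ℝ) →L[ℝ] ℝ)) W := fun l =>
    HasFDerivAt.finsetProd fun i _ => hasFDerivAt_apply i W
  have hloss := HasFDerivAt.fun_sum (u := Finset.univ) fun l _ =>
    (((hprod l).const_sub (z l)).pow 2).const_mul (ν l)
  rw [HasFDerivAt.fderiv hloss, Finset.sum_filter, Finset.mul_sum]
  simp only [sum_apply, smul_apply, neg_apply,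
    ContinuousLinearMap.proj_apply, smul_eq_mul]
  refine Finset.sum_congr rfl fun l _ => ?_
  simp only [Pi.single_apply, mul_ite, mul_one, mul_zero, Finset.sum_ite_eq']
  split_ifs
  · simp
    ring
  · simp

/-- If `w * g` equals `∑ u * h`, then a simultaneous step changes `w² - ∑ u²` only at second
order, by a difference of two nonnegative terms. -/
theorem abs_step_sub_le {ι : Type*} (s : Finset ι) (u h : ι → ℝ) (w g α B : ℝ)
    (hcons : w * g = ∑ l ∈ s, u l * h l) (hg : g ^ 2 ≤ B) (hh : ∑ l ∈ s, h l ^ 2 ≤ B) :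
    |((w - α * g) ^ 2 - ∑ l ∈ s, (u l - α * h l) ^ 2) - (w ^ 2 - ∑ l ∈ s, u l ^ 2)|
      ≤ α ^ 2 * B := by
  have hsum : ∑ l ∈ s, (u l - α * h l) ^ 2
      = ∑ l ∈ s, u l ^ 2 - 2 * α * ∑ l ∈ s, u l * h l + α ^ 2 * ∑ l ∈ s, h l ^ 2 := by
    simp only [Finset.mul_sum, ← Finset.sum_sub_distrib, ← Finset.sum_add_distrib]
    exact Finset.sum_congr rfl fun l _ => by ring
  have hnonneg : 0 ≤ ∑ l ∈ s, h l ^ 2 := Finset.sum_nonneg fun l _ => sq_nonneg _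
  have heq : ((w - α * g) ^ 2 - ∑ l ∈ s, (u l - α * h l) ^ 2) - (w ^ 2 - ∑ l ∈ s, u l ^ 2)
      = α ^ 2 * (g ^ 2 - ∑ l ∈ s, h l ^ 2) := by
    rw [hsum, ← hcons]; ring
  rw [heq, abs_mul, abs_of_nonneg (sq_nonneg α)]
  refine mul_le_mul_of_nonneg_left (abs_le.2 ⟨?_, ?_⟩) (sq_nonneg α) <;>
    linarith [sq_nonneg g]

/-- Weighted Cauchy–Schwarz with a uniform bound on the second factor. -/
theorem sq_sum_mul_le {ι : Type*} [Fintype ι] (s : Finset ι) (ν r q : ι → ℝ) (K : ℝ)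
    (hν : ∀ l, 0 ≤ ν l) (hK : 0 ≤ K) (hq : ∀ l ∈ s, q l ^ 2 ≤ K) :
    (∑ l ∈ s, ν l * r l * q l) ^ 2 ≤ (∑ l, ν l) * K * ∑ l, ν l * r l ^ 2 := by
  have hcs := Finset.sum_sq_le_sum_mul_sum_of_sq_le_mul s
    (r := fun l => ν l * r l * q l) (f := fun l => ν l * q l ^ 2) (g := fun l => ν l * r l ^ 2)
    (fun l _ => mul_nonneg (hν l) (sq_nonneg _)) (fun l _ => mul_nonneg (hν l) (sq_nonneg _))
    (fun l _ => (by ring : _ = _).le)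
  refine hcs.trans (mul_le_mul ?_ ?_ ?_ ?_)
  · calc ∑ l ∈ s, ν l * q l ^ 2 ≤ ∑ l ∈ s, ν l * K :=
          Finset.sum_le_sum fun l hl => mul_le_mul_of_nonneg_left (hq l hl) (hν l)
      _ ≤ ∑ l, ν l * K := Finset.sum_le_univ_sum_of_nonneg fun l => mul_nonneg (hν l) hK
      _ = (∑ l, ν l) * K := (Finset.sum_mul ..).symm
  · exact Finset.sum_le_univ_sum_of_nonneg fun l => mul_nonneg (hν l) (sq_nonneg _)
  · exact Finset.sum_nonneg fun l _ => mul_nonneg (hν l) (sq_nonneg _)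
  · exact mul_nonneg (Finset.sum_nonneg fun l _ => hν l) hK

/-- Termwise counterpart of `sq_sum_mul_le`. -/
theorem sum_sq_mul_le {ι : Type*} [Fintype ι] (s : Finset ι) (ν r q : ι → ℝ) (K : ℝ)
    (hν : ∀ l, 0 ≤ ν l) (hK : 0 ≤ K) (hq : ∀ l ∈ s, q l ^ 2 ≤ K) :
    ∑ l ∈ s, (ν l * r l * q l) ^ 2 ≤ (∑ l, ν l) * K * ∑ l, ν l * r l ^ 2 := by
  rw [Finset.mul_sum]
  refine (Finset.sum_le_sum fun l hl => ?_).trans (Finset.sum_le_univ_sum_of_nonneg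
    (f := fun l => (∑ l, ν l) * K * (ν l * r l ^ 2)) fun l => ?_)
  · calc (ν l * r l * q l) ^ 2 = ν l * q l ^ 2 * (ν l * r l ^ 2) := by ring
      _ ≤ (∑ l, ν l) * K * (ν l * r l ^ 2) :=
        mul_le_mul_of_nonneg_right
          (mul_le_mul (Finset.single_le_sum (fun i _ => hν i) (Finset.mem_univ l)) (hq l hl)
            (sq_nonneg _) (Finset.sum_nonneg fun i _ => hν i))
          (mul_nonneg (hν l) (sq_nonneg _))
  · exact mul_nonneg (mul_nonneg (Finset.sum_nonneg fun i _ => hν i) hK)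
      (mul_nonneg (hν l) (sq_nonneg _))

/-- On an arborescence of depth `L ≥ 1` (leaf-indexed paths), if
`C_f(W) = W_f² − ∑_{l∈𝓛(G;f)} W_l² > 0` for every non-leaf edge `f`, then one
gradient-descent step `W⁺ = W − α ∇ℐ(W)` satisfies, for every non-leaf edge `f`,
`|C_f(W⁺) − C_f(W)| ≤ 4 α² ‖ν‖₁ (max_{e∈E∖𝓛(G)} W_e²)^{L−1} ℐ(W)`; in particular if
`|W_e| ≤ M` for all non-leaf `e`, then
`|C_f(W⁺) − C_f(W)| ≤ 4 α² ‖ν‖₁ M^{2(L−1)} ℐ(W)`. -/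
theorem statement15 {E ι : Type*} [Fintype E] [DecidableEq E] [Fintype ι] [DecidableEq ι]
    (L : ℕ) (hL : 1 ≤ L) (path : ι → Finset E) (leafE : ι → E)
    (hcard : ∀ l, (path l).card = L)
    (hmem : ∀ l, leafE l ∈ path l)
    (hinj : Function.Injective leafE)
    (huniq : ∀ l l', leafE l ∈ path l' → l' = l)
    (hcover : ∀ e, ∃ l, e ∈ path l)
    (hne : (Finset.univ \ Finset.univ.image leafE).Nonempty)
    (ν : ι → ℝ) (hν : ∀ l, 0 < ν l) (z : ι → ℝ)
    (W : E → ℝ)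
    (hC : ∀ f, f ∉ Finset.univ.image leafE →
      0 < W f ^ 2 - ∑ l ∈ Finset.univ.filter fun l => f ∈ path l, W (leafE l) ^ 2)
    (α : ℝ) (hα : 0 < α) (f : E) (hf : f ∉ Finset.univ.image leafE) :
    (|((fun e => W e - α * fderiv ℝ
            (fun V : E → ℝ => ∑ l, ν l * (z l - ∏ e' ∈ path l, V e') ^ 2) W (Pi.single e 1)) f ^ 2
          - ∑ l ∈ Finset.univ.filter fun l => f ∈ path l,
              (fun e => W e - α * fderiv ℝ
                (fun V : E → ℝ => ∑ l', ν l' * (z l' - ∏ e' ∈ path l', V e') ^ 2) W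
                (Pi.single e 1)) (leafE l) ^ 2)
        - (W f ^ 2 - ∑ l ∈ Finset.univ.filter fun l => f ∈ path l, W (leafE l) ^ 2)|
      ≤ 4 * α ^ 2 * (∑ l, ν l) *
          ((Finset.univ \ Finset.univ.image leafE).sup' hne fun e => W e ^ 2) ^ (L - 1) *
          (∑ l, ν l * (z l - ∏ e ∈ path l, W e) ^ 2)) ∧
    ∀ M : ℝ, (∀ e, e ∉ Finset.univ.image leafE → |W e| ≤ M) →
      |((fun e => W e - α * fderiv ℝ
            (fun V : E → ℝ => ∑ l, ν l * (z l - ∏ e' ∈ path l, V e') ^ 2) W (Pi.single e 1)) f ^ 2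
          - ∑ l ∈ Finset.univ.filter fun l => f ∈ path l,
              (fun e => W e - α * fderiv ℝ
                (fun V : E → ℝ => ∑ l', ν l' * (z l' - ∏ e' ∈ path l', V e') ^ 2) W
                (Pi.single e 1)) (leafE l) ^ 2)
        - (W f ^ 2 - ∑ l ∈ Finset.univ.filter fun l => f ∈ path l, W (leafE l) ^ 2)|
        ≤ 4 * α ^ 2 * (∑ l, ν l) * M ^ (2 * (L - 1)) *
            (∑ l, ν l * (z l - ∏ e ∈ path l, W e) ^ 2) := by
  set m := (Finset.univ \ Finset.univ.image leafE).sup' hne fun e => W e ^ 2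
  have hle : ∀ e, e ∉ Finset.univ.image leafE → W e ^ 2 ≤ m := fun e he =>
    Finset.le_sup' (fun e => W e ^ 2) (by simpa using he)
  have hm0 : 0 ≤ m := (sq_nonneg _).trans (hle f hf)
  have hK : 0 ≤ m ^ (L - 1) := pow_nonneg hm0 _
  have hν0 : ∀ l, 0 ≤ ν l := fun l => (hν l).le
  have hI : 0 ≤ ∑ l, ν l * (z l - ∏ e ∈ path l, W e) ^ 2 :=
    Finset.sum_nonneg fun l _ => mul_nonneg (hν0 l) (sq_nonneg _)
  have hν1 : 0 ≤ ∑ l, ν l := Finset.sum_nonneg fun l _ => hν0 l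
  have hpath : ∀ l, f ∈ path l → ∀ e ∈ path l, W e ^ 2 ≤ m := by
    intro l hl e he
    by_cases hleaf : e ∈ Finset.univ.image leafE
    · obtain ⟨l', -, rfl⟩ := Finset.mem_image.1 hleaf
      obtain rfl := huniq l' l he
      have hsingle := Finset.single_le_sum (f := fun l => W (leafE l) ^ 2)
        (s := Finset.univ.filter fun l => f ∈ path l)
        (fun i _ => sq_nonneg _) (Finset.mem_filter.2 ⟨Finset.mem_univ l, hl⟩)
      have hfm := hle f hf
      have hCf := hC f hf
      linarith
    · exact hle e hleaf
  have herase : ∀ l, f ∈ path l → ∀ e ∈ path l,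
      (∏ e' ∈ (path l).erase e, W e') ^ 2 ≤ m ^ (L - 1) := by
    intro l hl e he
    rw [← Finset.prod_pow, ← hcard l, ← Finset.card_erase_of_mem he]
    exact (Finset.prod_le_prod (fun _ _ => sq_nonneg _) fun e' he' =>
      hpath l hl e' (Finset.mem_of_mem_erase he')).trans_eq (Finset.prod_const m)
  have hleaf : ∀ l, (Finset.univ.filter fun l' => leafE l ∈ path l') = {l} := by
    intro l
    ext l'
    simp only [Finset.mem_filter, Finset.mem_univ, true_and, Finset.mem_singleton]
    exact ⟨fun h => (huniq l l' h), fun h => h ▸ hmem l⟩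
  have hbound := abs_step_sub_le (Finset.univ.filter fun l => f ∈ path l)
    (fun l => W (leafE l))
    (fun l => fderiv ℝ
      (fun V : E → ℝ => ∑ l, ν l * (z l - ∏ e' ∈ path l, V e') ^ 2) W (Pi.single (leafE l) 1))
    (W f)
    (fderiv ℝ (fun V : E → ℝ => ∑ l, ν l * (z l - ∏ e' ∈ path l, V e') ^ 2) W (Pi.single f 1))
    α (4 * ((∑ l, ν l) * m ^ (L - 1) * ∑ l, ν l * (z l - ∏ e ∈ path l, W e) ^ 2)) ?_ ?_ ?_
  · replace hbound := hbound.trans_eq (show _ = 4 * α ^ 2 * (∑ l, ν l) * m ^ (L - 1) *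
      (∑ l, ν l * (z l - ∏ e ∈ path l, W e) ^ 2) by ring)
    refine ⟨hbound, fun M hM => hbound.trans ?_⟩
    have hmM : m ≤ M ^ 2 := Finset.sup'_le _ _ fun e he =>
      sq_le_sq.2 ((hM e (Finset.mem_sdiff.1 he).2).trans (le_abs_self M))
    rw [pow_mul]
    gcongr
  · simp only [fderiv_pathLoss_single, hleaf, Finset.sum_singleton, Finset.mul_sum]
    refine Finset.sum_congr rfl fun l hl => ?_
    have h1 := Finset.mul_prod_erase (path l) W (Finset.mem_filter.1 hl).2
    have h2 := Finset.mul_prod_erase (path l) W (hmem l)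
    linear_combination (-2 * ν l * (z l - ∏ e ∈ path l, W e)) * (h1 - h2)
  · rw [fderiv_pathLoss_single, mul_pow]
    norm_num only
    refine mul_le_mul_of_nonneg_left (sq_sum_mul_le _ ν _ _ _ hν0 hK fun l hl => ?_) (by norm_num)
    have hl := (Finset.mem_filter.1 hl).2
    exact herase l hl f hl
  · simp only [fderiv_pathLoss_single, hleaf, Finset.sum_singleton, mul_pow (-2 : ℝ)]
    rw [← Finset.mul_sum]
    norm_num only
    refine mul_le_mul_of_nonneg_left (sum_sq_mul_le _ ν _ _ _ hν0 hK fun l hl => ?_) (by norm_num)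
    exact herase l (Finset.mem_filter.1 hl).2 _ (hmem l)
end
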